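/- arXiv:0709.2174 — 2 statements merged into one kernel-verified Lean document; each statement's English description precedes it below -/
import Mathlib

section
/- Let G be a finitely generated solvable group of polynomial growth. Then every subgroup of G is finitely generated; that is, G is polycyclic. -/
open scoped BigOperators

/-- The ball of radius `n` in a group `G` with respect to a set `S`:
elements expressible as a product of at most `n` elements of `S`. -/
def ball {G : Type*} [Group G] (S : Set G) (n : ℕ) : Set G :=
  {g | ∃ l : List G, (∀ x ∈ l, x ∈ S) ∧ l.length ≤ n ∧ l.prod = g}

/-- The growth function of `G` relative to `S`: `γ_S(n) = |B_S(n)|`. -/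
noncomputable def growth {G : Type*} [Group G] (S : Set G) (n : ℕ) : ℕ := (ball S n).ncard

/-- A finite symmetric generating set of `G`. -/
def IsSymmGen {G : Type*} [Group G] (S : Finset G) : Prop :=
  (∀ x ∈ S, x⁻¹ ∈ S) ∧ Subgroup.closure (S : Set G) = ⊤

/-- `G` has polynomial growth: for some finite symmetric generating set `S`
there are `C > 0` and `k : ℕ` with `γ_S(n) ≤ C * n ^ k` for all `n ≥ 1`. -/
def HasPolyGrowth (G : Type*) [Group G] : Prop :=
  ∃ S : Finset G, IsSymmGen S ∧ ∃ C : ℝ, 0 < C ∧ ∃ k : ℕ,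
    ∀ n : ℕ, 1 ≤ n → (growth (S : Set G) n : ℝ) ≤ C * (n : ℝ) ^ k

open Subgroup

section Balls

variable {G : Type*} [Group G] {S : Set G}

lemma ball_mono {m n : ℕ} (h : m ≤ n) : ball S m ⊆ ball S n := by
  rintro g ⟨l, hl, hlen, rfl⟩
  exact ⟨l, hl, hlen.trans h, rfl⟩

lemma mul_mem_ball {a b : ℕ} {x y : G} (hx : x ∈ ball S a) (hy : y ∈ ball S b) :
    x * y ∈ ball S (a + b) := by
  obtain ⟨l, hl, hla, rfl⟩ := hx
  obtain ⟨m, hm, hmb, rfl⟩ := hy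
  refine ⟨l ++ m, ?_, ?_, by simp⟩
  · simpa [or_imp, forall_and] using ⟨hl, hm⟩
  · simpa using by omega

lemma finite_ball (hS : S.Finite) (n : ℕ) : (ball S n).Finite := by
  have : Finite S := hS
  refine ((List.finite_length_le S n).image fun l => (l.map Subtype.val).prod).subset ?_
  rintro g ⟨l, hl, hlen, rfl⟩
  lift l to List S using hl
  exact ⟨l, by simpa using hlen, rfl⟩

lemma exists_mem_ball {S : Finset G} (hS : IsSymmGen S) (g : G) :
    ∃ n, g ∈ ball (S : Set G) n := by
  have hg : g ∈ closure (S : Set G) := hS.2 ▸ mem_top g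
  induction hg using closure_induction'' with
  | one => exact ⟨0, [], by simp⟩
  | mem x hx => exact ⟨1, [x], by simpa using hx⟩
  | inv_mem x hx => exact ⟨1, [x⁻¹], by simpa using hS.1 x hx⟩
  | mul x y _ _ hx hy =>
    obtain ⟨m, hm⟩ := hx
    obtain ⟨n, hn⟩ := hy
    exact ⟨m + n, mul_mem_ball hm hn⟩

end Balls

section Map

variable {G G' : Type*} [Group G] [Group G']

lemma Subgroup.FG.map {H : Subgroup G} (hH : H.FG) (f : G →* G') : (H.map f).FG := by
  obtain ⟨S, rfl, hS⟩ := (fg_iff _).1 hH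
  exact (fg_iff _).2 ⟨f '' S, (f.map_closure S).symm, hS.image f⟩

lemma Subgroup.fg_of_fg_map_of_fg_inf_ker (f : G →* G') {H : Subgroup G}
    (hmap : (H.map f).FG) (hker : (H ⊓ f.ker).FG) : H.FG := by
  obtain ⟨T, hT, hTfin⟩ := (fg_iff _).1 hmap
  have hsub : T ⊆ f '' H := by
    rw [← coe_map, ← hT]
    exact subset_closure
  obtain ⟨U, hUH, hUfin, hU⟩ :=
    Set.exists_subset_image_finite_and (p := fun V => closure V = H.map f).1
      ⟨T, hsub, hTfin, hT⟩
  have hUH' : closure U ≤ H := (closure_le _).2 hUH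
  have hH : H = closure U ⊔ (H ⊓ f.ker) := by
    refine le_antisymm (fun h hh => ?_) (sup_le hUH' inf_le_left)
    have hfh : f h ∈ (closure U).map f := by
      rw [f.map_closure, hU]
      exact mem_map_of_mem f hh
    obtain ⟨u, hu, huh⟩ := hfh
    have hker : u⁻¹ * h ∈ H ⊓ f.ker :=
      ⟨H.mul_mem (H.inv_mem (hUH' hu)) hh, by simp [huh]⟩
    simpa using mul_mem_sup hu hker
  rw [hH]
  exact ((fg_iff _).2 ⟨U, rfl, hUfin⟩).sup hker

lemma Subgroup.fg_of_fg_map_of_injective {f : G →* G'} (hf : Function.Injective f)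
    {H : Subgroup G} (h : (H.map f).FG) : H.FG := by
  refine fg_of_fg_map_of_fg_inf_ker f h ?_
  rw [f.ker_eq_bot_iff.2 hf, inf_bot_eq]
  exact FG.bot

end Map

section Conjugates

variable {G : Type*} [Group G]

/-- The products `x₀ ^ ε₀ * ⋯ * xₙ₋₁ ^ εₙ₋₁` with `εᵢ ∈ {0, 1}` and `xᵢ = t ^ i * x * (t ^ i)⁻¹`. -/
def conjProducts [DecidableEq G] (x t : G) : ℕ → Finset G
  | 0 => {1}
  | n + 1 => conjProducts x t n ∪ (conjProducts x t n).image (· * (t ^ n * x * (t ^ n)⁻¹))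

lemma conjProducts_subset [DecidableEq G] (x t : G) (n : ℕ) :
    ∀ w ∈ conjProducts x t n,
      w ∈ closure ((fun i : ℕ => t ^ i * x * (t ^ i)⁻¹) '' Set.Iio n) := by
  induction n with
  | zero => simp [conjProducts]
  | succ n ih =>
    have hle : closure ((fun i : ℕ => t ^ i * x * (t ^ i)⁻¹) '' Set.Iio n) ≤
        closure ((fun i : ℕ => t ^ i * x * (t ^ i)⁻¹) '' Set.Iio (n + 1)) :=
      closure_mono (Set.image_mono (Set.Iio_subset_Iio n.le_succ))
    intro w hw
    rw [conjProducts, Finset.mem_union, Finset.mem_image] at hw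
    rcases hw with hw | ⟨v, hv, rfl⟩
    · exact hle (ih w hw)
    · exact mul_mem (hle (ih v hv)) (subset_closure ⟨n, by simp, rfl⟩)

lemma conjProducts_mul_pow_mem_ball [DecidableEq G] {S : Set G} {x t : G} {a b : ℕ}
    (hx : x ∈ ball S a) (ht : t ∈ ball S b) (n : ℕ) :
    ∀ w ∈ conjProducts x t n, w * t ^ n ∈ ball S ((a + b) * n) := by
  induction n with
  | zero =>
    intro w hw
    obtain rfl : w = 1 := by simpa [conjProducts] using hw
    exact ⟨[], by simp⟩
  | succ n ih =>
    intro w hw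
    rw [conjProducts, Finset.mem_union, Finset.mem_image] at hw
    rcases hw with hw | ⟨v, hv, rfl⟩
    · rw [pow_succ, ← mul_assoc]
      exact ball_mono (by lia) (mul_mem_ball (ih w hw) ht)
    · have : v * (t ^ n * x * (t ^ n)⁻¹) * t ^ (n + 1) = v * t ^ n * (x * t) := by group
      rw [this, mul_add_one]
      exact mul_mem_ball (ih v hv) (mul_mem_ball hx ht)

lemma card_conjProducts [DecidableEq G] {x t : G}
    (h : ∀ m : ℕ, t ^ m * x * (t ^ m)⁻¹ ∉
      closure ((fun i : ℕ => t ^ i * x * (t ^ i)⁻¹) '' Set.Iio m)) (n : ℕ) :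
    (conjProducts x t n).card = 2 ^ n := by
  induction n with
  | zero => simp [conjProducts]
  | succ n ih =>
    rw [conjProducts, Finset.card_union_of_disjoint,
      Finset.card_image_of_injective _ (mul_left_injective _), ih]
    · ring
    · rw [Finset.disjoint_left]
      intro w hw hw'
      obtain ⟨v, hv, rfl⟩ := Finset.mem_image.1 hw'
      exact h n (((Subgroup.closure _).mul_mem_cancel_left (conjProducts_subset x t n v hv)).1
        (conjProducts_subset x t n _ hw))

lemma HasPolyGrowth.exists_conj_mem_closure (hG : HasPolyGrowth G) (x t : G) :
    ∃ m : ℕ, t ^ m * x * (t ^ m)⁻¹ ∈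
      closure ((fun i : ℕ => t ^ i * x * (t ^ i)⁻¹) '' Set.Iio m) := by
  classical
  by_contra! h
  obtain ⟨S, hS, C, hC, k, hk⟩ := hG
  obtain ⟨a, ha⟩ := exists_mem_ball hS x
  obtain ⟨b, hb⟩ := exists_mem_ball hS t
  have hb' : t ∈ ball (S : Set G) (b + 1) := ball_mono b.le_succ hb
  set D := a + (b + 1)
  have hcard (n : ℕ) : 2 ^ n ≤ growth (S : Set G) (D * n) := by
    rw [← card_conjProducts h n, growth, ← Set.ncard_coe_finset]
    exact Set.ncard_le_ncard_of_injOn (· * t ^ n) (conjProducts_mul_pow_mem_ball ha hb' n)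
      (mul_left_injective _).injOn (finite_ball S.finite_toSet _)
  have hlim := (tendsto_pow_const_div_const_pow_of_one_lt k (one_lt_two (α := ℝ))).const_mul
    (C * (D : ℝ) ^ k)
  rw [mul_zero] at hlim
  obtain ⟨n, hn1, hn⟩ :=
    ((hlim.eventually_lt_const one_pos).and (Filter.eventually_ge_atTop 1)).exists
  have h1 : ((2 : ℝ)) ^ n ≤ C * ((D * n : ℕ) : ℝ) ^ k :=
    le_trans (by exact_mod_cast hcard n) (hk (D * n) (Nat.mul_pos (by omega) hn))
  rw [← mul_div_assoc, div_lt_one (by positivity)] at hn1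
  push_cast [mul_pow] at h1
  linarith

lemma conj_pow_mem_closure_of_mem {x t : G} {m : ℕ}
    (h : t ^ m * x * (t ^ m)⁻¹ ∈ closure ((fun i : ℕ => t ^ i * x * (t ^ i)⁻¹) '' Set.Iio m))
    (n : ℕ) :
    t ^ n * x * (t ^ n)⁻¹ ∈ closure ((fun i : ℕ => t ^ i * x * (t ^ i)⁻¹) '' Set.Iio m) := by
  set A := closure ((fun i : ℕ => t ^ i * x * (t ^ i)⁻¹) '' Set.Iio m) with hA
  have hconj : A ≤ A.comap (MulAut.conj t).toMonoidHom := by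
    rw [hA, closure_le]
    rintro _ ⟨i, hi, rfl⟩
    have key : t * (t ^ i * x * (t ^ i)⁻¹) * t⁻¹ = t ^ (i + 1) * x * (t ^ (i + 1))⁻¹ := by
      group
    simp only [coe_comap, Set.mem_preimage, MulEquiv.toMonoidHom_eq_coe, MonoidHom.coe_coe,
      MulAut.conj_apply, key]
    rcases (Nat.succ_le_of_lt hi).lt_or_eq with h' | h'
    · exact subset_closure ⟨i + 1, h', rfl⟩
    · subst h'
      exact h
  induction n with
  | zero =>
    rcases m.eq_zero_or_pos with rfl | hm
    · exact h
    · exact subset_closure ⟨0, hm, rfl⟩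
  | succ n ih =>
    have := hconj ih
    have key : t * (t ^ n * x * (t ^ n)⁻¹) * t⁻¹ = t ^ (n + 1) * x * (t ^ (n + 1))⁻¹ := by
      group
    simpa only [mem_comap, MulEquiv.toMonoidHom_eq_coe, MonoidHom.coe_coe,
      MulAut.conj_apply, key] using this

/-- The conjugates of any element by the powers of any other one generate a finitely generated
subgroup. -/
def HasFGConjOrbits (G : Type*) [Group G] : Prop :=
  ∀ x t : G, (closure (Set.range fun i : ℤ => t ^ i * x * (t ^ i)⁻¹)).FG

lemma HasPolyGrowth.hasFGConjOrbits (hG : HasPolyGrowth G) : HasFGConjOrbits G := by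
  intro x t
  obtain ⟨m, hm⟩ := hG.exists_conj_mem_closure x t
  obtain ⟨m', hm'⟩ := hG.exists_conj_mem_closure x t⁻¹
  have hfin : ((fun i : ℕ => t ^ i * x * (t ^ i)⁻¹) '' Set.Iio m ∪
      (fun i : ℕ => t⁻¹ ^ i * x * (t⁻¹ ^ i)⁻¹) '' Set.Iio m').Finite :=
    ((Set.finite_Iio m).image _).union ((Set.finite_Iio m').image _)
  refine (fg_iff _).2 ⟨_, le_antisymm ?_ ?_, hfin⟩
  · apply Subgroup.closure_mono
    rintro _ (⟨i, -, rfl⟩ | ⟨i, -, rfl⟩)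
    · exact ⟨i, by simp⟩
    · exact ⟨-i, by simp⟩
  · rw [closure_le, Subgroup.closure_union]
    rintro _ ⟨i, rfl⟩
    obtain ⟨n, rfl | rfl⟩ := i.eq_nat_or_neg
    · simpa using mem_sup_left (conj_pow_mem_closure_of_mem hm n)
    · simpa using mem_sup_right (conj_pow_mem_closure_of_mem hm' n)

lemma HasFGConjOrbits.subgroup (hG : HasFGConjOrbits G) (K : Subgroup G) : HasFGConjOrbits K := by
  intro x t
  have h := hG x t
  have hmap : (closure (Set.range fun i : ℤ => t ^ i * x * (t ^ i)⁻¹)).map K.subtype =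
      closure (Set.range fun i : ℤ => (t : G) ^ i * x * ((t : G) ^ i)⁻¹) := by
    rw [MonoidHom.map_closure, ← Set.range_comp]
    congr 2
  exact fg_of_fg_map_of_injective K.subtype_injective (hmap ▸ h)

end Conjugates

section FinitelyGenerated

variable {G : Type*} [Group G]

lemma Subgroup.fg_of_commGroup_fg {A : Type*} [CommGroup A] [Group.FG A] (H : Subgroup A) :
    H.FG := by
  have : Module.Finite ℤ (Additive A) := Module.Finite.iff_addGroup_fg.2 inferInstance
  rw [fg_iff_add_fg, ← AddSubgroup.toIntSubmodule_toAddSubgroup H.toAddSubgroup,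
    ← Submodule.fg_iff_addSubgroup_fg]
  exact IsNoetherian.noetherian _

lemma Subgroup.fg_inf_zpowers (N : Subgroup G) (t : G) : (N ⊓ zpowers t).FG := by
  have h := (fg_of_commGroup_fg (N.comap (zpowersHom G t))).map (zpowersHom G t)
  rwa [map_comap_eq, inf_comm] at h

/-- A normal subgroup `N` with `N ⊔ zpowers t` finitely generated is finitely generated. -/
lemma HasFGConjOrbits.fg_of_fg_sup_zpowers (hG : HasFGConjOrbits G) {N : Subgroup G} [N.Normal]
    {t : G} (h : (N ⊔ zpowers t).FG) : N.FG := by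
  obtain ⟨S, hS, hSfin⟩ := (fg_iff _).1 h
  have hmem (s : G) (hs : s ∈ S) : ∃ n ∈ N, n⁻¹ * s ∈ zpowers t := by
    have : s ∈ N ⊔ zpowers t := hS ▸ subset_closure hs
    obtain ⟨n, hn, z, hz, rfl⟩ := mem_sup_of_normal_left.1 this
    exact ⟨n, hn, by simpa⟩
  choose! ν hνN hνt using hmem
  set M : Subgroup G := ⨆ s ∈ S, closure (Set.range fun i : ℤ => t ^ i * ν s * (t ^ i)⁻¹)
  have hMfg : M.FG := FG.biSup hSfin _ fun s _ => hG (ν s) t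
  have hMN : M ≤ N := by
    refine iSup₂_le fun s hs => (closure_le _).2 ?_
    rintro _ ⟨i, rfl⟩
    exact ‹N.Normal›.conj_mem _ (hνN s hs) _
  have hνM (s : G) (hs : s ∈ S) : ν s ∈ M :=
    (le_iSup₂_of_le (f := fun s (_ : s ∈ S) =>
      closure (Set.range fun i : ℤ => t ^ i * ν s * (t ^ i)⁻¹)) s hs le_rfl)
      (subset_closure ⟨0, by simp⟩)
  have hconj (j : ℤ) : M ≤ M.comap (MulAut.conj (t ^ j)).toMonoidHom := by
    refine iSup₂_le fun s hs => (closure_le _).2 ?_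
    rintro _ ⟨i, rfl⟩
    refine (le_iSup₂_of_le (f := fun s (_ : s ∈ S) =>
      closure (Set.range fun i : ℤ => t ^ i * ν s * (t ^ i)⁻¹)) s hs le_rfl)
      (subset_closure ⟨j + i, ?_⟩)
    simp only [zpow_add, mul_inv_rev, MulEquiv.toMonoidHom_eq_coe, MonoidHom.coe_coe,
      MulAut.conj_apply, mul_assoc]
  have hnorm : zpowers t ≤ normalizer (M : Set G) := by
    rw [zpowers_le, mem_normalizer_iff]
    intro m
    refine ⟨fun hm => by simpa using hconj 1 hm, fun hm => ?_⟩
    simpa [mul_assoc] using hconj (-1) hm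
  have hle : N ≤ M ⊔ zpowers t := by
    refine le_sup_left.trans (hS ▸ (closure_le _).2 fun s hs => ?_ : N ⊔ zpowers t ≤ _)
    simpa using mul_mem_sup (hνM s hs) (hνt s hs)
  have hN : N = M ⊔ (N ⊓ zpowers t) := by
    refine le_antisymm (fun n hn => ?_) (sup_le hMN inf_le_left)
    have hn' : n ∈ ((M ⊔ zpowers t : Subgroup G) : Set G) := hle hn
    rw [coe_mul_of_right_le_normalizer_left _ _ hnorm] at hn'
    obtain ⟨m, hm, z, hz, rfl⟩ := hn'
    exact mul_mem_sup hm ⟨(N.mul_mem_cancel_left (hMN hm)).1 hn, hz⟩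
  rw [hN]
  exact hMfg.sup (fg_inf_zpowers N t)

lemma HasFGConjOrbits.fg_of_fg_sup_closure (hG : HasFGConjOrbits G) {s : Set G} (hs : s.Finite) :
    ∀ {N : Subgroup G}, _root_.commutator G ≤ N → (N ⊔ closure s).FG → N.FG := by
  induction s, hs using Set.Finite.induction_on with
  | empty => simp
  | @insert a s _ _ ih =>
    intro N hN h
    have : (N ⊔ closure s).Normal :=
      Subgroup.Normal.of_commutator_le _ (hN.trans (le_sup_left (b := closure s)))
    refine ih hN (hG.fg_of_fg_sup_zpowers (t := a) ?_)
    rwa [Set.insert_eq, Subgroup.closure_union, ← zpowers_eq_closure, sup_comm (zpowers a),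
      ← sup_assoc] at h

lemma HasFGConjOrbits.fg_commutator (hG : HasFGConjOrbits G) [hfg : Group.FG G] :
    (_root_.commutator G).FG := by
  obtain ⟨S, hS, hSfin⟩ := Group.fg_iff.1 hfg
  refine hG.fg_of_fg_sup_closure hSfin le_rfl ?_
  rw [hS, sup_top_eq]
  exact Group.fg_def.1 hfg

lemma HasFGConjOrbits.fg_commutator_self (hG : HasFGConjOrbits G) {K : Subgroup G} (hK : K.FG) :
    ⁅K, K⁆.FG := by
  have : Group.FG K := (Group.fg_iff_subgroup_fg K).2 hK
  rw [← map_subtype_commutator]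
  exact (hG.subgroup K).fg_commutator.map _

lemma HasFGConjOrbits.fg_derivedSeries (hG : HasFGConjOrbits G) [hfg : Group.FG G] (n : ℕ) :
    (derivedSeries G n).FG := by
  induction n with
  | zero => exact Group.fg_def.1 hfg
  | succ n ih => exact hG.fg_commutator_self ih

lemma Subgroup.fg_of_fg_inf_commutator [Group.FG G] {H : Subgroup G}
    (h : (H ⊓ _root_.commutator G).FG) : H.FG := by
  refine fg_of_fg_map_of_fg_inf_ker (Abelianization.of (G := G)) ?_ ?_
  · have : Group.FG (Abelianization G) := QuotientGroup.fg _
    exact fg_of_commGroup_fg _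
  · rwa [Abelianization.ker_of]

lemma Subgroup.fg_of_fg_inf_commutator_self {H K : Subgroup G} (hK : K.FG) (hHK : H ≤ K)
    (h : (H ⊓ ⁅K, K⁆).FG) : H.FG := by
  have : Group.FG K := (Group.fg_iff_subgroup_fg K).2 hK
  rw [← map_subgroupOf_eq_of_le hHK] at h ⊢
  refine (fg_of_fg_inf_commutator (fg_of_fg_map_of_injective K.subtype_injective ?_)).map _
  rwa [map_inf _ _ _ K.subtype_injective, map_subtype_commutator]

end FinitelyGenerated

/-- A finitely generated solvable group of polynomial growth is polycyclic:
every subgroup is finitely generated. -/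
theorem stmt10 {G : Type*} [Group G] (hfg : Group.FG G) (hsolv : IsSolvable G)
    (hpg : HasPolyGrowth G) :
    ∀ H : Subgroup G, H.FG := by
  intro H
  obtain ⟨n, hn⟩ := (Group.isSolvable_def G).1 hsolv
  have hinf : ∀ m ≤ n, (H ⊓ derivedSeries G m).FG := by
    intro m hm
    induction hm using Nat.decreasingInduction with
    | self => simpa [hn] using FG.bot
    | of_succ m _ ih =>
      refine fg_of_fg_inf_commutator_self (hpg.hasFGConjOrbits.fg_derivedSeries m) inf_le_right ?_
      rwa [inf_assoc, ← derivedSeries_succ,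
        inf_eq_right.2 (derivedSeries_antitone G m.le_succ)]
  simpa using hinf 0 n.zero_le
end

section
/- (Tits) Let G be a finitely generated subgroup of the general linear group GL_n(ℂ). If G has polynomial growth, then G contains a nilpotent subgroup of finite index. -/
open scoped BigOperators

section PolyGrowth

open scoped Pointwise

/-- Every finitely generated subgroup of `G` has growth of degree at most `d`. -/
def HasGrowthDegree (G : Type*) [Group G] (d : ℕ) : Prop :=
  ∀ T : Set G, T.Finite → ∃ C : ℕ, ∀ n : ℕ, (T ^ n).ncard ≤ C * (n + 1) ^ d

theorem HasGrowthDegree.subgroup {G : Type*} [Group G] {d : ℕ} (h : HasGrowthDegree G d)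
    (H : Subgroup G) : HasGrowthDegree H d := by
  intro T hT
  obtain ⟨C, hC⟩ := h (H.subtype '' T) (hT.image _)
  refine ⟨C, fun n => ?_⟩
  have := hC n
  rwa [← Set.image_pow, Set.ncard_image_of_injective _ H.subtype_injective] at this

theorem finite_pow {G : Type*} [Monoid G] {T : Set G} (hT : T.Finite) (n : ℕ) :
    (T ^ n).Finite := by
  induction n with
  | zero => simp
  | succ n ih => rw [pow_succ]; exact ih.mul hT

theorem HasGrowthDegree.card_le {G : Type*} [Group G] {d : ℕ} (h : HasGrowthDegree G d)
    {T : Set G} (hT : T.Finite) :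
    ∃ C : ℕ, ∀ (n : ℕ) (ι : Type) [Fintype ι] (f : ι → G), Function.Injective f →
      (∀ i, f i ∈ T ^ n) → Fintype.card ι ≤ C * (n + 1) ^ d := by
  obtain ⟨C, hC⟩ := h T hT
  refine ⟨C, fun n ι _ f hf hfT => (le_trans ?_ (hC n))⟩
  have hfin : (T ^ n).Finite := finite_pow hT n
  rw [← Nat.card_eq_fintype_card, ← Set.ncard_univ, ← Set.ncard_image_of_injective _ hf]
  exact Set.ncard_le_ncard (by rintro _ ⟨i, -, rfl⟩; exact hfT i) hfin

theorem pow_subset_ball {G : Type*} [Group G] (S : Set G) (n : ℕ) : S ^ n ⊆ ball S n := by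
  induction n with
  | zero => rintro x rfl; exact ⟨[], by simp⟩
  | succ n ih =>
    rw [pow_succ']
    rintro _ ⟨a, ha, b, hb, rfl⟩
    obtain ⟨l, hl, hn, rfl⟩ := ih hb
    exact ⟨a :: l, by simpa using ⟨ha, hl⟩, by simpa using hn, by simp⟩

theorem ball_subset_pow {G : Type*} [Group G] (S : Set G) (n : ℕ) :
    ball S n ⊆ (insert 1 S) ^ n := by
  rintro _ ⟨l, hl, hn, rfl⟩
  refine Set.pow_subset_pow_right (Set.mem_insert _ _) hn ?_
  clear hn
  induction l with
  | nil => simp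
  | cons a l ih =>
    rw [List.length_cons, pow_succ', List.prod_cons]
    exact Set.mul_mem_mul (Or.inr (hl a (by simp))) (ih fun x hx => hl x (by simp [hx]))

theorem exists_mem_pow_of_closure_eq_top {G : Type*} [Group G] {S : Set G}
    (hinv : ∀ x ∈ S, x⁻¹ ∈ S) (hS : Subgroup.closure S = ⊤) (g : G) : ∃ n : ℕ, g ∈ S ^ n := by
  have hg : g ∈ Subgroup.closure S := hS ▸ Subgroup.mem_top g
  induction hg using Subgroup.closure_induction'' with
  | one => exact ⟨0, by simp⟩
  | mem x hx => exact ⟨1, by simpa using hx⟩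
  | inv_mem x hx => exact ⟨1, by simpa using hinv x hx⟩
  | mul x y _ _ hx hy =>
    obtain ⟨m, hm⟩ := hx
    obtain ⟨n, hn⟩ := hy
    exact ⟨m + n, by rw [pow_add]; exact Set.mul_mem_mul hm hn⟩

theorem HasPolyGrowth.exists_hasGrowthDegree {G : Type*} [Group G] (h : HasPolyGrowth G) :
    ∃ d : ℕ, HasGrowthDegree G d := by
  obtain ⟨S, ⟨hinv, hS⟩, C, hC, d, hd⟩ := h
  refine ⟨d, fun T hT => ?_⟩
  set S' : Set G := insert 1 (S : Set G) with hS'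
  have hfin : S'.Finite := S.finite_toSet.insert 1
  have hinv' : ∀ x ∈ S', x⁻¹ ∈ S' := by
    rintro x (rfl | hx)
    · simp [hS']
    · exact Or.inr (hinv x hx)
  have hball : ∀ n, S' ^ n ⊆ ball (S : Set G) n := by
    intro n x hx
    obtain ⟨l, hl, hn, rfl⟩ := pow_subset_ball S' n hx
    classical
    refine ⟨l.filter (· ≠ 1), ?_, (List.length_filter_le _ _).trans hn, ?_⟩
    · intro x hx
      rw [List.mem_filter] at hx
      rcases hl x hx.1 with h | h
      · simp [h] at hx
      · exact h
    · clear hl hn hx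
      induction l with
      | nil => simp
      | cons a l ih => by_cases ha : a = 1 <;> simp_all
  have hgen : Subgroup.closure S' = ⊤ :=
    top_le_iff.1 (hS.symm.le.trans (Subgroup.closure_mono (Set.subset_insert _ _)))
  choose r hr using exists_mem_pow_of_closure_eq_top hinv' hgen
  set R := hT.toFinset.sup r with hR
  have hTR : T ⊆ S' ^ R := fun x hx =>
    Set.pow_subset_pow_right (Set.mem_insert _ _)
      (Finset.le_sup (f := r) (hT.mem_toFinset.2 hx)) (hr x)
  refine ⟨⌈C⌉₊ * (R + 1) ^ d, fun n => ?_⟩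
  have hsub : T ^ n ⊆ ball (S : Set G) ((R + 1) * (n + 1)) := by
    refine (Set.pow_subset_pow_left hTR).trans ?_
    rw [← pow_mul]
    exact (Set.pow_subset_pow_right (Set.mem_insert _ _) (by nlinarith)).trans (hball _)
  have h1 := Set.ncard_le_ncard hsub ((finite_pow hfin _).subset (ball_subset_pow _ _))
  have h2 := hd ((R + 1) * (n + 1)) (Nat.succ_le_of_lt (by positivity))
  have h3 : (growth (S : Set G) ((R + 1) * (n + 1)) : ℝ) ≤
      ((⌈C⌉₊ * (R + 1) ^ d * (n + 1) ^ d : ℕ) : ℝ) := by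
    refine h2.trans ?_
    push_cast
    rw [mul_pow, mul_assoc]
    gcongr
    exact Nat.le_ceil C
  exact h1.trans (by exact_mod_cast h3)

end PolyGrowth

section Kronecker

open Polynomial

/-- `z` is a root of a nonzero integer polynomial with coefficients in `{-1, 0, 1}`. -/
def IsLittlewoodRoot (z : ℂ) : Prop :=
  ∃ p : ℤ[X], p ≠ 0 ∧ (∀ i, |p.coeff i| ≤ 1) ∧ aeval z p = 0

theorem IsLittlewoodRoot.isIntegral {z : ℂ} (h : IsLittlewoodRoot z) : IsIntegral ℤ z := by
  obtain ⟨p, hp, hc, hz⟩ := h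
  have hl : p.leadingCoeff ≠ 0 := leadingCoeff_ne_zero.2 hp
  have hl1 : |p.leadingCoeff| ≤ 1 := hc _
  rcases Int.abs_le_one_iff.1 hl1 with h | h | h
  · exact absurd h hl
  · exact ⟨p, h, by simpa [aeval_def] using hz⟩
  · exact ⟨-p, by simp [Monic, h], by simpa [aeval_def] using hz⟩

theorem norm_lt_two_of_coeff_le_one {p : ℤ[X]} (hp : p ≠ 0) (hc : ∀ i, |p.coeff i| ≤ 1)
    {z : ℂ} (hz : aeval z p = 0) : ‖z‖ < 2 := by
  have hinj : Function.Injective (Int.castRingHom ℂ) := Int.cast_injective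
  set q : ℂ[X] := p.map (Int.castRingHom ℂ) with hq
  have hq0 : q ≠ 0 := (Polynomial.map_ne_zero_iff hinj).2 hp
  have hroot : q.IsRoot z := by
    rw [IsRoot, hq, eval_map, ← hz, aeval_def]; rfl
  refine lt_of_lt_of_le (hroot.norm_lt_cauchyBound hq0) ?_
  have hlead : (1 : NNReal) ≤ ‖q.leadingCoeff‖₊ := by
    rw [hq, leadingCoeff_map_of_injective hinj, ← NNReal.coe_le_coe]
    have : (1 : ℤ) ≤ |p.leadingCoeff| := Int.one_le_abs (leadingCoeff_ne_zero.2 hp)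
    have h2 : ((1 : ℤ) : ℝ) ≤ (|p.leadingCoeff| : ℤ) := by exact_mod_cast this
    simpa [Int.norm_eq_abs] using h2
  have hcoef : ∀ i, ‖q.coeff i‖₊ ≤ 1 := by
    intro i
    rw [hq, coeff_map, ← NNReal.coe_le_coe]
    have h2 : ((|p.coeff i| : ℤ) : ℝ) ≤ (1 : ℤ) := by exact_mod_cast hc i
    simpa [Int.norm_eq_abs] using h2
  have hb : cauchyBound q ≤ 2 := by
    rw [cauchyBound]
    have : (Finset.range q.natDegree).sup (fun i => ‖q.coeff i‖₊) / ‖q.leadingCoeff‖₊ ≤ 1 :=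
      div_le_one_of_le₀ ((Finset.sup_le fun i _ => hcoef i).trans hlead) zero_le
    calc _ ≤ (1 : NNReal) + 1 := by gcongr
      _ = 2 := by norm_num
  exact_mod_cast hb

theorem exists_pow_eq_one_of_isLittlewoodRoot {z : ℂ} (hz : z ≠ 0)
    (h : ∀ j : ℕ, 0 < j → IsLittlewoodRoot (z ^ j)) : ∃ n : ℕ, 0 < n ∧ z ^ n = 1 := by
  have h_int : IsIntegral ℤ z := by simpa using (h 1 one_pos).isIntegral
  have hintQ : IsIntegral ℚ z := h_int.tower_top
  let K := IntermediateField.adjoin ℚ {z}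
  have : FiniteDimensional ℚ K := IntermediateField.adjoin.finiteDimensional hintQ
  have : NumberField K := ⟨⟩
  let x : K := IntermediateField.AdjoinSimple.gen ℚ z
  have hx : algebraMap K ℂ x = z := IntermediateField.AdjoinSimple.algebraMap_gen ℚ z
  have hinj : Function.Injective (algebraMap K ℂ) := (algebraMap K ℂ).injective
  have hx0 : x ≠ 0 := by
    rintro h0
    rw [h0, map_zero] at hx
    exact hz hx.symm
  have hxi : IsIntegral ℤ x := by
    rw [← isIntegral_algebraMap_iff (B := ℂ) hinj, hx]; exact h_int
  have hbound : ∀ φ : K →+* ℂ, ‖φ x‖ ≤ 1 := by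
    intro φ
    by_contra hlt
    push Not at hlt
    obtain ⟨j, hj⟩ := pow_unbounded_of_one_lt 2 hlt
    have hj0 : 0 < j := by
      rcases Nat.eq_zero_or_pos j with rfl | h0
      · norm_num at hj
      · exact h0
    obtain ⟨p, hp, hc, hpz⟩ := h j hj0
    have hpx : aeval (x ^ j) p = 0 := by
      apply hinj
      rw [map_zero, ← hpz, ← aeval_algebraMap_apply, map_pow, hx]
    have hφ : aeval (φ x ^ j) p = 0 := by
      have := congrArg φ hpx
      rw [map_zero, aeval_def, hom_eval₂, map_pow] at this
      rw [aeval_def, ← this]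
      congr 1
      exact RingHom.ext_int _ _
    have := norm_lt_two_of_coeff_le_one hp hc hφ
    rw [norm_pow] at this
    exact lt_asymm this hj
  obtain ⟨n, hn, hxn⟩ := NumberField.Embeddings.pow_eq_one_of_norm_le_one K ℂ hx0 hxi hbound
  refine ⟨n, hn, ?_⟩
  rw [← hx, ← map_pow, hxn, map_one]

/-- The polynomial with the given `0`-`1` coefficients. -/
noncomputable def binaryPoly : List Bool → ℤ[X]
  | [] => 0
  | b :: l => C (if b then 1 else 0) + X * binaryPoly l

theorem coeff_binaryPoly (l : List Bool) (i : ℕ) :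
    (binaryPoly l).coeff i = if l.getD i false then 1 else 0 := by
  induction l generalizing i with
  | nil => simp [binaryPoly]
  | cons b l ih => cases b <;> cases i <;> simp [binaryPoly, ih, coeff_one]

theorem isLittlewoodRoot_of_aeval_binaryPoly_eq {z : ℂ} {l l' : List Bool}
    (hlen : l.length = l'.length) (hne : l ≠ l')
    (h : aeval z (binaryPoly l) = aeval z (binaryPoly l')) : IsLittlewoodRoot z := by
  refine ⟨binaryPoly l - binaryPoly l', ?_, fun i => ?_, by simp [h]⟩
  · intro h0
    apply hne
    apply List.ext_getElem hlen
    intro i hi hi'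
    have := congrArg (fun p => coeff p i) h0
    simp only [coeff_sub, coeff_binaryPoly, coeff_zero] at this
    rw [List.getD_eq_getElem _ _ hi, List.getD_eq_getElem _ _ hi'] at this
    revert this
    cases l[i] <;> cases l'[i] <;> simp
  · rw [coeff_sub, coeff_binaryPoly, coeff_binaryPoly]
    split_ifs <;> simp

end Kronecker

section GrowthOfConjugates

open scoped Pointwise

theorem exists_mul_pow_lt_pow (C : ℝ) (d : ℕ) {b : ℝ} (hb : 1 < b) :
    ∃ m : ℕ, C * ((m : ℝ) + 1) ^ d < b ^ m := by
  have h := tendsto_pow_const_div_const_pow_of_one_lt d hb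
  have h' := ((h.comp (Filter.tendsto_add_atTop_nat 1)).const_mul (|C| * b)).eventually
    (gt_mem_nhds (show |C| * b * 0 < 1 by simp))
  obtain ⟨m, hm⟩ := h'.exists
  refine ⟨m, ?_⟩
  have hb0 : 0 < b := by linarith
  have hbm : 0 < b ^ m := by positivity
  simp only [Function.comp, Nat.cast_add, Nat.cast_one] at hm
  have h2 : |C| * b * (((m : ℝ) + 1) ^ d / b ^ (m + 1)) = |C| * ((m : ℝ) + 1) ^ d / b ^ m := by
    rw [pow_succ]; field_simp
  rw [h2, div_lt_one hbm] at hm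
  refine lt_of_le_of_lt ?_ hm
  gcongr
  exact le_abs_self C

/-- The product `x ^ e₀ * (g * x * g⁻¹) ^ e₁ * (g ^ 2 * x * g⁻¹ ^ 2) ^ e₂ * ⋯`. -/
def conjWord {H : Type*} [Group H] (x g : H) : List Bool → H
  | [] => 1
  | b :: l => (if b then x else 1) * (g * conjWord x g l * g⁻¹)

theorem conjWord_mem_pow {H : Type*} [Group H] (x g : H) (l : List Bool) :
    conjWord x g l ∈ ({1, x, g, g⁻¹} : Set H) ^ (3 * l.length) := by
  induction l with
  | nil => simp [conjWord]
  | cons b l ih =>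
    have : 3 * (b :: l).length = 1 + (1 + 3 * l.length + 1) := by
      simp only [List.length_cons]; ring
    rw [this, pow_add _ 1, pow_add, pow_add, pow_one]
    refine Set.mul_mem_mul (by cases b <;> simp) (Set.mul_mem_mul (Set.mul_mem_mul ?_ ih) ?_) <;>
      simp

theorem isLittlewoodRoot_of_conj {H Q : Type*} [Group H] [AddCommGroup Q] [Module ℂ Q] {d : ℕ}
    (hd : HasGrowthDegree H d) (U : Subgroup H) (φ : H → Q)
    (hφ : ∀ a ∈ U, ∀ b ∈ U, φ (a * b) = φ a + φ b) {g x : H} {z : ℂ}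
    (hgU : ∀ a ∈ U, g * a * g⁻¹ ∈ U) (hg : ∀ a ∈ U, φ (g * a * g⁻¹) = z • φ a)
    (hxU : x ∈ U) (hx : φ x ≠ 0) : IsLittlewoodRoot z := by
  have h1 : φ 1 = 0 := by
    have := hφ 1 U.one_mem 1 U.one_mem
    simpa using this
  have key : ∀ l, conjWord x g l ∈ U ∧
      φ (conjWord x g l) = Polynomial.aeval z (binaryPoly l) • φ x := by
    intro l
    induction l with
    | nil => simp [conjWord, binaryPoly, h1, U.one_mem]
    | cons b l ih =>
      have hb : (if b then x else 1) ∈ U := by cases b <;> simp [hxU, U.one_mem]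
      refine ⟨U.mul_mem hb (hgU _ ih.1), ?_⟩
      rw [conjWord, hφ _ hb _ (hgU _ ih.1), hg _ ih.1, ih.2]
      cases b <;> simp [binaryPoly, h1, add_smul, mul_smul]
  by_contra hcon
  obtain ⟨C, hC⟩ := hd.card_le (T := {1, x, g, g⁻¹}) (by simp)
  obtain ⟨m, hm⟩ := exists_mul_pow_lt_pow (C * 3 ^ d : ℝ) d (b := 2) (by norm_num)
  have hcard := hC (3 * m) (List.Vector Bool m) (fun l => conjWord x g l.1) ?_ ?_
  · rw [card_vector, Fintype.card_bool] at hcard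
    have h2 : C * (3 * m + 1) ^ d ≤ C * 3 ^ d * (m + 1) ^ d := by
      rw [mul_assoc, ← mul_pow]; gcongr; omega
    have h3 : ((2 ^ m : ℕ) : ℝ) ≤ ((C * 3 ^ d * (m + 1) ^ d : ℕ) : ℝ) :=
      Nat.cast_le.2 (hcard.trans h2)
    push_cast at h3
    exact absurd hm (not_lt.2 h3)
  · intro l l' hl
    by_contra hne
    apply hcon
    refine isLittlewoodRoot_of_aeval_binaryPoly_eq (l := l.1) (l' := l'.1)
      (by rw [l.2, l'.2]) (fun h => hne (Subtype.ext h)) ?_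
    have := congrArg φ hl
    simp only [(key _).2] at this
    exact smul_left_injective ℂ hx this
  · intro l
    have := conjWord_mem_pow x g l.1
    rwa [l.2] at this

/-- In a group of polynomial growth, conjugation acts on additive characters of a subgroup
through roots of unity. -/
theorem exists_pow_eq_one_of_conj {H Q : Type*} [Group H] [AddCommGroup Q] [Module ℂ Q] {d : ℕ}
    (hd : HasGrowthDegree H d) (U : Subgroup H) (φ : H → Q)
    (hφ : ∀ a ∈ U, ∀ b ∈ U, φ (a * b) = φ a + φ b) {g x : H} {z : ℂ} (hz : z ≠ 0)
    (hgU : ∀ a ∈ U, g * a * g⁻¹ ∈ U) (hg : ∀ a ∈ U, φ (g * a * g⁻¹) = z • φ a)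
    (hxU : x ∈ U) (hx : φ x ≠ 0) : ∃ n : ℕ, 0 < n ∧ z ^ n = 1 := by
  refine exists_pow_eq_one_of_isLittlewoodRoot hz fun j _ => ?_
  have key : ∀ a ∈ U, g ^ j * a * (g ^ j)⁻¹ ∈ U ∧ φ (g ^ j * a * (g ^ j)⁻¹) = z ^ j • φ a := by
    intro a ha
    clear * - ha hgU hg
    induction j with
    | zero => simpa using ha
    | succ j ih =>
      have : g ^ (j + 1) * a * (g ^ (j + 1))⁻¹ = g * (g ^ j * a * (g ^ j)⁻¹) * g⁻¹ := by
        rw [pow_succ']; group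
      rw [this]
      exact ⟨hgU _ ih.1, by rw [hg _ ih.1, ih.2, pow_succ', mul_smul]⟩
  exact isLittlewoodRoot_of_conj hd U φ hφ (fun a ha => (key a ha).1)
    (fun a ha => (key a ha).2) hxU hx

end GrowthOfConjugates

section TorsionFree

theorem CommGroup.exists_pow_eq_one_of_fg (A : Type*) [CommGroup A] [Group.FG A] :
    ∃ m : ℕ, 0 < m ∧ ∀ a : A, IsOfFinOrder a → a ^ m = 1 := by
  have : Module.Finite ℤ (Additive A) :=
    Module.Finite.iff_addGroup_fg.2 inferInstance
  let T : Submodule ℤ (Additive A) := (Subgroup.toAddSubgroup (CommGroup.torsion A)).toIntSubmodule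
  have hT : Finite T := by
    have : AddGroup.FG T := Module.Finite.iff_addGroup_fg.1 inferInstance
    refine AddCommGroup.finite_of_fg_isAddTorsion T ?_
    rintro ⟨x, hx⟩
    have hx' : IsOfFinOrder (Additive.toMul x) := hx
    obtain ⟨n, hn, hnx⟩ := isOfFinOrder_iff_pow_eq_one.1 hx'
    exact isOfFinAddOrder_iff_nsmul_eq_zero.2 ⟨n, hn, Subtype.ext hnx⟩
  refine ⟨Nat.card T, Nat.card_pos, fun a ha => ?_⟩
  have := card_nsmul_eq_zero' (x := (⟨Additive.ofMul a, ha⟩ : T))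
  exact congrArg Subtype.val this

theorem MonoidHom.exists_finiteIndex_eq_one {G A : Type*} [Group G] [Group.FG G] [CommGroup A]
    (ψ : G →* A) : ∃ H : Subgroup G, H.FiniteIndex ∧
      ∀ h ∈ H, ∀ n : ℕ, 0 < n → ψ h ^ n = 1 → ψ h = 1 := by
  have : Group.FG ψ.range := Group.fg_range ψ
  obtain ⟨m, hm, hA⟩ := CommGroup.exists_pow_eq_one_of_fg ψ.range
  have hfi := Subgroup.finiteIndex_range_powMonoidHom_of_fg ψ.range hm.ne'
  refine ⟨(powMonoidHom (α := ψ.range) m).range.comap ψ.rangeRestrict, ⟨?_⟩, ?_⟩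
  · rw [Subgroup.index_comap_of_surjective _ ψ.rangeRestrict_surjective]
    exact hfi.index_ne_zero
  · rintro h ⟨a, ha⟩ n hn hn1
    have ha' : (a : A) ^ m = ψ h := congrArg Subtype.val ha
    have : a ^ m = 1 := by
      refine hA a (isOfFinOrder_iff_pow_eq_one.2 ⟨m * n, by positivity, Subtype.ext ?_⟩)
      rw [pow_mul]
      push_cast
      rw [ha', hn1]
    rw [← ha', ← Subgroup.coe_pow, this, Subgroup.coe_one]

end TorsionFree

section WeightFlag

open scoped commutatorElement

/-- A flag of subrepresentations `F 0 = ⊥ ≤ F 1 ≤ ⋯ ≤ F N = ⊤` such that `G` acts on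
`F (i + 1) / F i` through the character `χ i`. -/
structure IsWeightFlag {G V : Type*} [Group G] [AddCommGroup V] [Module ℂ V]
    (ρ : Representation ℂ G V) (N : ℕ) (F : ℕ → Submodule ℂ V) (χ : ℕ → G →* ℂˣ) : Prop where
  mono : Monotone F
  bot : F 0 = ⊥
  top : F N = ⊤
  sub_smul_mem : ∀ i g, ∀ v ∈ F (i + 1), ρ g v - (χ i g : ℂ) • v ∈ F i
  eq_one : ∀ i, N ≤ i → χ i = 1

namespace IsWeightFlag

variable {G V : Type*} [Group G] [AddCommGroup V] [Module ℂ V]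
  {ρ : Representation ℂ G V} {N : ℕ} {F : ℕ → Submodule ℂ V} {χ : ℕ → G →* ℂˣ}

theorem apply_mem (h : IsWeightFlag ρ N F χ) (g : G) {i : ℕ} {v : V} (hv : v ∈ F i) :
    ρ g v ∈ F i := by
  cases i with
  | zero =>
    rw [h.bot, Submodule.mem_bot] at hv ⊢
    rw [hv, map_zero]
  | succ i =>
    have := (F (i + 1)).add_mem (h.mono (Nat.le_succ i) (h.sub_smul_mem i g v hv))
      ((F (i + 1)).smul_mem (χ i g : ℂ) hv)
    simpa using this

theorem comp {G' : Type*} [Group G'] (h : IsWeightFlag ρ N F χ) (f : G' →* G) :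
    IsWeightFlag (ρ.comp f) N F (fun i => (χ i).comp f) where
  mono := h.mono
  bot := h.bot
  top := h.top
  sub_smul_mem i g v hv := h.sub_smul_mem i (f g) v hv
  eq_one i hi := by rw [h.eq_one i hi]; rfl

/-- The elements moving each vector of `F i` by a vector of `F (i - s)`. -/
def depth (h : IsWeightFlag ρ N F χ) (s : ℕ) : Subgroup G where
  carrier := {g | ∀ i, ∀ v ∈ F i, ρ g v - v ∈ F (i - s)}
  one_mem' := by intro i v _; simp
  mul_mem' := by
    intro a b ha hb i v hv
    have := (F (i - s)).add_mem (h.apply_mem a (hb i v hv)) (ha i v hv)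
    simpa using this
  inv_mem' := by
    intro a ha i v hv
    have := (F (i - s)).neg_mem (h.apply_mem a⁻¹ (ha i v hv))
    simpa using this

theorem mem_depth (h : IsWeightFlag ρ N F χ) {s : ℕ} {g : G} :
    g ∈ h.depth s ↔ ∀ i, ∀ v ∈ F i, ρ g v - v ∈ F (i - s) := Iff.rfl

theorem conj_mem_depth (h : IsWeightFlag ρ N F χ) {s : ℕ} (g : G) {a : G} (ha : a ∈ h.depth s) :
    g * a * g⁻¹ ∈ h.depth s := by
  intro i v hv
  have := h.apply_mem g (ha i _ (h.apply_mem g⁻¹ hv))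
  simpa using this

theorem mkQ_conj (h : IsWeightFlag ρ N F χ) {s j : ℕ} (g : G) {a : G} (ha : a ∈ h.depth s)
    {w : V} (hw : w ∈ F (j + s + 1)) :
    (F j).mkQ (ρ (g * a * g⁻¹) w - w) =
      ((χ j g * (χ (j + s) g)⁻¹ : ℂˣ) : ℂ) • (F j).mkQ (ρ a w - w) := by
  rw [← map_smul, ← sub_eq_zero, ← map_sub, ← LinearMap.mem_ker, Submodule.ker_mkQ]
  set r := ρ g⁻¹ w - (χ (j + s) g⁻¹ : ℂ) • w with hr
  have hrF : r ∈ F (j + s) := h.sub_smul_mem _ _ _ hw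
  have har : ρ a r - r ∈ F j := by simpa using ha _ _ hrF
  have hy : ρ a w - w ∈ F (j + 1) := by
    have := ha _ _ hw
    rwa [show j + s + 1 - s = j + 1 by omega] at this
  have hgy := h.sub_smul_mem j g _ hy
  have hmem := (F j).add_mem ((F j).smul_mem (χ (j + s) g⁻¹ : ℂ) hgy) (h.apply_mem g har)
  have hw' : ρ g⁻¹ w = (χ (j + s) g⁻¹ : ℂ) • w + r := by rw [hr]; abel
  have hgw : w = ρ g (ρ g⁻¹ w) := by simp
  have hexp : ρ (g * a * g⁻¹) w - w = ρ g (ρ a (ρ g⁻¹ w) - ρ g⁻¹ w) := by simp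
  rw [hexp, hw']
  convert hmem using 1
  simp only [map_add, map_sub, map_smul, map_inv, Units.val_mul]
  module

theorem commutator_mem_depth (h : IsWeightFlag ρ N F χ) {d : ℕ} (hd : HasGrowthDegree G d)
    (htf : ∀ i j g, ∀ n : ℕ, 0 < n → (χ i g * (χ j g)⁻¹) ^ n = 1 → χ i g = χ j g)
    {s : ℕ} {x : G} (hx : x ∈ h.depth s) (g : G) : ⁅x, g⁆ ∈ h.depth (s + 1) := by
  intro i v hv
  set w := ρ (x⁻¹ * g⁻¹) v with hwdef
  have hw : w ∈ F i := h.apply_mem _ hv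
  have hexp : ρ ⁅x, g⁆ v - v = (ρ x (ρ g w) - ρ g w) - ρ g (ρ x w - w) := by
    simp [hwdef, commutatorElement_def]
  rw [hexp]
  rcases Nat.lt_or_ge s i with hsi | hsi
  · obtain ⟨j, rfl⟩ : ∃ j, i = j + s + 1 := ⟨i - s - 1, by omega⟩
    rw [show j + s + 1 - (s + 1) = j by omega]
    set y := ρ x w - w with hydef
    have hy : y ∈ F (j + 1) := by
      have := hx _ _ hw
      rwa [show j + s + 1 - s = j + 1 by omega] at this
    set r := ρ g w - (χ (j + s) g : ℂ) • w with hr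
    have hrF : r ∈ F (j + s) := h.sub_smul_mem _ g _ hw
    have hxr : ρ x r - r ∈ F j := by
      have := hx _ _ hrF
      rwa [Nat.add_sub_cancel] at this
    have hgy := h.sub_smul_mem j g _ hy
    have hgw : ρ g w = (χ (j + s) g : ℂ) • w + r := by rw [hr]; abel
    have hy' : ((χ (j + s) g : ℂ) - (χ j g : ℂ)) • y ∈ F j := by
      by_cases hyj : y ∈ F j
      · exact (F j).smul_mem _ hyj
      have hχ : χ j g = χ (j + s) g := by
        rcases Nat.eq_zero_or_pos s with rfl | hs
        · rfl
        have hadd : ∀ a ∈ h.depth s, ∀ b ∈ h.depth s, (F j).mkQ (ρ (a * b) w - w) =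
            (F j).mkQ (ρ a w - w) + (F j).mkQ (ρ b w - w) := by
          intro a ha b hb
          rw [← map_add, ← sub_eq_zero, ← map_sub, ← LinearMap.mem_ker, Submodule.ker_mkQ]
          have hb' := hb _ _ hw
          rw [show j + s + 1 - s = j + 1 by omega] at hb'
          have := h.mono (show j + 1 - s ≤ j by omega) (ha _ _ hb')
          convert this using 1
          simp only [map_mul, Module.End.mul_apply, map_sub]
          abel
        obtain ⟨n, hn, hn1⟩ := exists_pow_eq_one_of_conj hd (h.depth s)
          (fun u => (F j).mkQ (ρ u w - w)) hadd (Units.ne_zero (χ j g * (χ (j + s) g)⁻¹))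
          (fun a ha => h.conj_mem_depth g ha) (fun a ha => h.mkQ_conj g ha hw) hx
          (by simpa only [Submodule.mkQ_apply, ne_eq, Submodule.Quotient.mk_eq_zero] using hyj)
        exact htf _ _ _ n hn (Units.ext (by simpa using hn1))
      rw [hχ, sub_self, zero_smul]
      exact (F j).zero_mem
    have hmem := (F j).add_mem ((F j).add_mem hy' hxr) ((F j).neg_mem hgy)
    convert hmem using 1
    rw [hgw]
    simp only [map_add, map_smul, hydef]
    module
  · have hz : ∀ u ∈ F i, ρ x u - u = 0 := by
      intro u hu
      have := hx i u hu
      rwa [Nat.sub_eq_zero_of_le hsi, h.bot, Submodule.mem_bot] at this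
    rw [hz _ hw, hz _ (h.apply_mem g hw), map_zero, sub_zero]
    exact Submodule.zero_mem _

theorem isNilpotent (h : IsWeightFlag ρ N F χ) {d : ℕ} (hd : HasGrowthDegree G d)
    (htf : ∀ i j g, ∀ n : ℕ, 0 < n → (χ i g * (χ j g)⁻¹) ^ n = 1 → χ i g = χ j g)
    (hρ : Function.Injective ρ) : Group.IsNilpotent G := by
  refine (Subgroup.nilpotent_iff_finite_descending_central_series G).2
    ⟨N, h.depth, ⟨?_, fun x s hx g => h.commutator_mem_depth hd htf hx g⟩, ?_⟩
  · refine top_le_iff.1 fun g _ i v hv => ?_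
    exact (F i).sub_mem (h.apply_mem g hv) hv
  · refine (Subgroup.eq_bot_iff_forall _).2 fun g hg => hρ ?_
    ext v
    have := hg N v (h.top ▸ Submodule.mem_top)
    rw [Nat.sub_self, h.bot, Submodule.mem_bot, sub_eq_zero] at this
    simpa using this

theorem exists_isNilpotent (h : IsWeightFlag ρ N F χ) [Group.FG G] {d : ℕ}
    (hd : HasGrowthDegree G d) (hρ : Function.Injective ρ) :
    ∃ H : Subgroup G, Group.IsNilpotent H ∧ H.FiniteIndex := by
  choose K hK hK1 using fun p : Fin (N + 1) × Fin (N + 1) =>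
    (χ p.1 * (χ p.2)⁻¹).exists_finiteIndex_eq_one
  refine ⟨⨅ p, K p, ?_, Subgroup.finiteIndex_iInf hK⟩
  refine (h.comp (⨅ p, K p).subtype).isNilpotent (hd.subgroup _) ?_
    (hρ.comp (Subgroup.subtype_injective _))
  intro i j g n hn hg
  have hmin : ∀ i, χ i = χ (min i N) := by
    intro i
    rcases le_total i N with hi | hi
    · rw [min_eq_left hi]
    · rw [min_eq_right hi, h.eq_one i hi, h.eq_one N le_rfl]
  have hgK := (Subgroup.mem_iInf.1 g.2) (⟨min i N, by omega⟩, ⟨min j N, by omega⟩)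
  simp only [MonoidHom.comp_apply] at hg ⊢
  rw [hmin i, hmin j] at hg ⊢
  exact mul_inv_eq_one.1 (hK1 _ _ hgK n hn hg)

end IsWeightFlag

end WeightFlag

section InvariantMeasure

open scoped Pointwise Topology BoundedContinuousFunction
open MeasureTheory Filter

theorem HasGrowthDegree.exists_ncard_pow_succ_le {G : Type*} [Group G] {d : ℕ}
    (hd : HasGrowthDegree G d) {S : Set G} (hS : S.Finite) {ε : ℝ} (hε : 0 < ε) :
    ∃ n : ℕ, ((S ^ (n + 1)).ncard : ℝ) ≤ (1 + ε) * (S ^ n).ncard := by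
  by_contra! h
  obtain ⟨C, hC⟩ := hd S hS
  obtain ⟨m, hm⟩ := exists_mul_pow_lt_pow (C : ℝ) d (b := 1 + ε) (by linarith)
  have key : ∀ n : ℕ, (1 + ε) ^ n ≤ ((S ^ n).ncard : ℝ) := by
    intro n
    induction n with
    | zero => simp [← Set.singleton_one]
    | succ n ih =>
      rw [pow_succ']
      exact (mul_le_mul_of_nonneg_left ih (by linarith)).trans (h n).le
  have h2 : ((S ^ m).ncard : ℝ) ≤ C * ((m : ℝ) + 1) ^ d := by exact_mod_cast hC m
  linarith [key m]

theorem abs_sum_smul_sub_sum_le {G : Type*} [Group G] [DecidableEq G] {A B : Finset G} (s : G)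
    (hAB : A ⊆ B) (hsAB : s • A ⊆ B) (f : G → ℝ) {M : ℝ} (hf : ∀ g, |f g| ≤ M) :
    |∑ g ∈ A, f (s * g) - ∑ g ∈ A, f g| ≤ 2 * M * ((B.card : ℝ) - A.card) := by
  have e1 : ∑ g ∈ A, f (s * g) = ∑ g ∈ s • A, f g := by
    rw [Finset.smul_finset_def, Finset.sum_image (by simp)]
    rfl
  have key : ∀ D ⊆ B, |∑ g ∈ B, f g - ∑ g ∈ D, f g| ≤ M * ((B.card : ℝ) - D.card) := by
    intro D hD
    rw [← Finset.sum_sdiff_eq_sub hD]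
    refine (Finset.abs_sum_le_sum_abs _ _).trans ((Finset.sum_le_card_nsmul _ _ M
      fun g _ => hf g).trans ?_)
    rw [nsmul_eq_mul, Finset.card_sdiff_of_subset hD, Nat.cast_sub (Finset.card_le_card hD)]
    exact (mul_comm _ _).le
  have h1 := key A hAB
  have h2 := key _ hsAB
  rw [Finset.card_smul_finset] at h2
  rw [e1]
  rw [abs_le] at *
  constructor <;> linarith [h1.1, h1.2, h2.1, h2.2]

variable {G X : Type*} [Group G] [TopologicalSpace X] [T2Space X]
  [MeasurableSpace X] [BorelSpace X]

theorem exists_integral_comp_sub_integral_le {d : ℕ}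
    (hd : HasGrowthDegree G d) {S : Set G} (hS : S.Finite) (h1 : 1 ∈ S)
    (T : G → X → X) (hT : ∀ g h x, T (g * h) x = T g (T h x)) (hc : ∀ g, Continuous (T g))
    [Nonempty X] {ε : ℝ} (hε : 0 < ε) :
    ∃ μ : ProbabilityMeasure X, ∀ s ∈ S, ∀ f : X →ᵇ ℝ,
      |∫ x, f (T s x) ∂(μ : Measure X) - ∫ x, f x ∂(μ : Measure X)| ≤ ε * ‖f‖ := by
  classical
  obtain ⟨n, hn⟩ := hd.exists_ncard_pow_succ_le hS (half_pos hε)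
  have hfA := finite_pow hS n
  have hfB := finite_pow hS (n + 1)
  set A := hfA.toFinset with hA
  set B := hfB.toFinset with hB
  rw [Set.ncard_eq_toFinset_card _ hfA, Set.ncard_eq_toFinset_card _ hfB] at hn
  have hAB : A ⊆ B := by
    simp only [hA, hB, Set.Finite.toFinset_subset_toFinset]
    exact Set.pow_subset_pow_right h1 n.le_succ
  have hA0 : A.Nonempty := ⟨1, by
    simpa [hA] using Set.pow_subset_pow_right h1 (Nat.zero_le n) (by simp)⟩
  have hcard : (0 : ℝ) < A.card := by exact_mod_cast hA0.card_pos
  obtain ⟨x₀⟩ := ‹Nonempty X›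
  set ν : Measure X := ((A.card : ENNReal)⁻¹) • ∑ g ∈ A, Measure.dirac (T g x₀) with hν
  have hp : IsProbabilityMeasure ν := by
    constructor
    simp only [hν, Measure.smul_apply, Measure.finsetSum_apply, measure_univ, smul_eq_mul,
      Finset.sum_const, nsmul_eq_mul, mul_one]
    exact ENNReal.inv_mul_cancel (by exact_mod_cast hA0.card_pos.ne') (by simp)
  have h_int : ∀ f : X → ℝ, Continuous f → ∫ x, f x ∂ν = (A.card : ℝ)⁻¹ * ∑ g ∈ A, f (T g x₀) := by
    intro f hf
    rw [hν, integral_smul_measure, integral_finsetSum_measure]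
    · simp [integral_dirac]
    · intro g _
      exact integrable_dirac (by simp)
  refine ⟨⟨ν, hp⟩, fun s hs f => ?_⟩
  rw [ProbabilityMeasure.coe_mk, h_int f f.continuous,
    h_int (fun x => f (T s x)) (f.continuous.comp (hc s)), ← mul_sub]
  have := abs_sum_smul_sub_sum_le s hAB (B := B) (by
    intro x hx
    obtain ⟨a, ha, rfl⟩ := Finset.mem_smul_finset.1 hx
    simp only [hA, hB, Set.Finite.mem_toFinset] at *
    rw [pow_succ']
    exact Set.mul_mem_mul hs ha) (fun g => f (T g x₀)) (M := ‖f‖) (fun g => f.norm_coe_le_norm _)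
  simp only [hT] at this
  rw [abs_mul, abs_inv, abs_of_pos hcard, inv_mul_le_iff₀ hcard]
  refine this.trans ?_
  have := norm_nonneg f
  nlinarith

theorem exists_invariant_probabilityMeasure [CompactSpace X] [HasOuterApproxClosed X] [Nonempty X]
    [Group.FG G] {d : ℕ} (hd : HasGrowthDegree G d)
    (T : G → X → X) (hT : ∀ g h x, T (g * h) x = T g (T h x)) (hT1 : ∀ x, T 1 x = x)
    (hc : ∀ g, Continuous (T g)) :
    ∃ μ : Measure X, IsProbabilityMeasure μ ∧ ∀ g, μ.map (T g) = μ := by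
  obtain ⟨S₀, hS₀, hfin⟩ := (Group.fg_iff (G := G)).1 ‹_›
  set S : Set G := insert 1 S₀ with hS
  have hSfin : S.Finite := hfin.insert 1
  have hex : ∀ k : ℕ, ∃ μ : ProbabilityMeasure X, ∀ s ∈ S, ∀ f : X →ᵇ ℝ,
      |∫ x, f (T s x) ∂(μ : Measure X) - ∫ x, f x ∂(μ : Measure X)| ≤ 1 / ((k : ℝ) + 1) * ‖f‖ :=
    fun k => exists_integral_comp_sub_integral_le hd hSfin (by simp [hS]) T hT hc (by positivity)
  choose μs hμs using hex
  obtain ⟨U, hU⟩ := Ultrafilter.exists_le (atTop : Filter ℕ)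
  obtain ⟨μ, -, hμ⟩ := isCompact_univ.ultrafilter_le_nhds (U.map μs) (by simp)
  have hlim : Tendsto μs U (𝓝 μ) := hμ
  rw [ProbabilityMeasure.tendsto_iff_forall_integral_tendsto] at hlim
  have hinv : ∀ s ∈ S, (μ : Measure X).map (T s) = μ := by
    intro s hs
    have : IsProbabilityMeasure ((μ : Measure X).map (T s)) :=
      Measure.isProbabilityMeasure_map (hc s).measurable.aemeasurable
    refine ext_of_forall_integral_eq_of_IsFiniteMeasure fun f => ?_
    rw [integral_map (hc s).measurable.aemeasurable f.continuous.aestronglyMeasurable]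
    have h1 := (hlim (f.compContinuous ⟨T s, hc s⟩)).sub (hlim f)
    have h2 : Tendsto (fun k : ℕ => 1 / ((k : ℝ) + 1) * ‖f‖) U (𝓝 (0 * ‖f‖)) :=
      (tendsto_one_div_add_atTop_nhds_zero_nat.mono_left hU).mul_const _
    rw [zero_mul] at h2
    have h3 := squeeze_zero_norm
      (a := fun k : ℕ => 1 / ((k : ℝ) + 1) * ‖f‖) (t₀ := (U : Filter ℕ))
      (f := fun k => ∫ x, f (T s x) ∂(μs k : Measure X) - ∫ x, f x ∂(μs k : Measure X))
      (fun k => hμs k s hs f) h2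
    exact sub_eq_zero.1 (tendsto_nhds_unique h1 h3)
  refine ⟨μ, inferInstance, fun g => ?_⟩
  have hcomp : ∀ g h, (μ : Measure X).map (T (g * h)) = ((μ : Measure X).map (T h)).map (T g) := by
    intro g h
    rw [Measure.map_map (hc g).measurable (hc h).measurable]
    congr 1
    exact funext (hT g h)
  have hid : (μ : Measure X).map (T 1) = μ := by
    rw [show T 1 = id from funext hT1, Measure.map_id]
  have hg : g ∈ Subgroup.closure S₀ := hS₀ ▸ Subgroup.mem_top g
  induction hg using Subgroup.closure_induction with
  | mem x hx => exact hinv x (Or.inr hx)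
  | one => exact hid
  | mul x y _ _ hx hy => rw [hcomp, hy, hx]
  | inv x _ hx =>
    conv_lhs => rw [← hx]
    rw [← hcomp, inv_mul_cancel, hid]

end InvariantMeasure

section ProjectiveMeasure

open scoped Topology
open MeasureTheory Filter

theorem Subgroup.finiteIndex_of_finite_range {G α : Type*} [Group G] {H : Subgroup G} {f : G → α}
    (hf : (Set.range f).Finite) (h : ∀ a b, f a = f b → a⁻¹ * b ∈ H) : H.FiniteIndex := by
  have := hf.to_subtype
  have : Finite (G ⧸ H) :=
    Finite.of_injective (fun q : G ⧸ H => (⟨f q.out, q.out, rfl⟩ : Set.range f)) fun p q hpq => by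
      rw [← p.out_eq', ← q.out_eq']
      exact QuotientGroup.eq.2 (h _ _ (congrArg Subtype.val hpq))
  exact Subgroup.finiteIndex_of_finite_quotient

variable {G V : Type*} [Group G] [NormedAddCommGroup V] [NormedSpace ℂ V] [FiniteDimensional ℂ V]
  [MeasurableSpace V] [BorelSpace V]

theorem exists_invariant_measure_unit_sphere [Nontrivial V] [Group.FG G] {d : ℕ}
    (hd : HasGrowthDegree G d) (ρ : G →* (V →L[ℂ] V)) :
    ∃ μ : Measure V, IsProbabilityMeasure μ ∧ (∀ᵐ x ∂μ, ‖x‖ = 1) ∧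
      ∀ g, μ.map (fun x => (‖ρ g x‖⁻¹ : ℂ) • ρ g x) = μ := by
  have hinj : ∀ g x, ρ g x = 0 → x = 0 := by
    intro g x hx
    have : ρ (g⁻¹ * g) x = 0 := by rw [map_mul, mul_apply_eq_comp, hx, map_zero]
    simpa using this
  have hproper : ProperSpace V := FiniteDimensional.proper ℂ V
  let X : Set V := Metric.sphere (0 : V) 1
  have hX : ∀ x : X, ‖(x : V)‖ = 1 := fun x => mem_sphere_zero_iff_norm.1 x.2
  have hne : ∀ g (x : X), ρ g x ≠ 0 := fun g x h => by
    simpa [hinj g x h] using hX x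
  let T : G → X → X := fun g x => ⟨(‖ρ g x‖⁻¹ : ℂ) • ρ g x, by
    have := norm_ne_zero_iff.2 (hne g x)
    exact mem_sphere_zero_iff_norm.2 (by simp [norm_smul, this])⟩
  have : Nonempty X := by
    obtain ⟨x, hx⟩ := exists_norm_eq V (zero_le_one)
    exact ⟨⟨x, mem_sphere_zero_iff_norm.2 hx⟩⟩
  have : CompactSpace X := isCompact_iff_compactSpace.1 (isCompact_sphere _ _)
  have hTc : ∀ g, Continuous (T g) := fun g =>
    Continuous.subtype_mk (Continuous.smul (Continuous.inv₀ (by fun_prop) (by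
      intro x
      exact_mod_cast norm_ne_zero_iff.2 (hne g x))) (by fun_prop)) _
  obtain ⟨μ, hμ, hinv⟩ := exists_invariant_probabilityMeasure hd T
    (fun g h x => by
      have h1 := norm_ne_zero_iff.2 (hne h x)
      have h2 := norm_ne_zero_iff.2 (hne (g * h) x)
      have h3 : ((‖ρ h x‖ : ℝ) : ℂ) ≠ 0 := by exact_mod_cast h1
      apply Subtype.ext
      simp only [T, map_mul, mul_apply_eq_comp, map_smul, norm_smul, smul_smul]
      congr 1
      simp only [norm_inv, Complex.norm_real, norm_norm]
      push_cast
      field_simp)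
    (fun x => by
      apply Subtype.ext
      simp [T, hX x]) hTc
  refine ⟨μ.map Subtype.val, Measure.isProbabilityMeasure_map measurable_subtype_coe.aemeasurable,
    ?_, fun g => ?_⟩
  · rw [ae_map_iff measurable_subtype_coe.aemeasurable
      (measurableSet_eq_fun (by fun_prop) (by fun_prop))]
    exact Eventually.of_forall hX
  · rw [Measure.map_map (by fun_prop) measurable_subtype_coe]
    conv_rhs => rw [← hinv g, Measure.map_map measurable_subtype_coe (hTc g).measurable]
    rfl

variable {μ : Measure V} {ρ : G →* (V →L[ℂ] V)}

theorem measure_comap_eq (hμ : ∀ g, μ.map (fun x => (‖ρ g x‖⁻¹ : ℂ) • ρ g x) = μ)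
    (W : Submodule ℂ V) (g : G) : μ (W.comap (ρ g : V →ₗ[ℂ] V)) = μ W := by
  have hW : MeasurableSet (W : Set V) := W.closed_of_finiteDimensional.measurableSet
  conv_rhs => rw [← hμ g, Measure.map_apply (by fun_prop) hW]
  congr 1
  ext x
  by_cases hx : ρ g x = 0
  · simp [hx]
  · have : (‖ρ g x‖⁻¹ : ℂ) ≠ 0 := by simpa using hx
    simp only [Submodule.comap_coe, Set.mem_preimage, SetLike.mem_coe]
    exact (W.smul_mem_iff this).symm

theorem finite_setOf_measure_submodule [IsFiniteMeasure μ] {m : ℕ}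
    (hm : ∀ W : Submodule ℂ V, Module.finrank ℂ W < m → μ W = 0) {ε : ENNReal} (hε : 0 < ε) :
    {W : Submodule ℂ V | Module.finrank ℂ W = m ∧ ε ≤ μ W}.Finite := by
  have h := Measure.finite_const_le_meas_of_disjoint_iUnion₀ μ hε
    (As := fun W : {W : Submodule ℂ V // Module.finrank ℂ W = m} => ((W : Submodule ℂ V) : Set V))
    (fun W => W.1.closed_of_finiteDimensional.measurableSet.nullMeasurableSet)
    (fun W W' hW => by
      refine hm (W.1 ⊓ W'.1) (lt_of_le_of_ne ?_ fun h => ?_)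
      · exact (Submodule.finrank_mono inf_le_left).trans W.2.le
      · have h1 := Submodule.eq_of_le_of_finrank_eq (inf_le_left : W.1 ⊓ W'.1 ≤ W.1)
          (h.trans W.2.symm)
        have h2 := Submodule.eq_of_le_of_finrank_eq (inf_le_right : W.1 ⊓ W'.1 ≤ W'.1)
          (h.trans W'.2.symm)
        exact hW (Subtype.ext (h1.symm.trans h2)))
    (measure_ne_top _ _)
  refine (h.image Subtype.val).subset ?_
  rintro W ⟨h1, h2⟩
  exact ⟨⟨W, h1⟩, h2, rfl⟩

theorem exists_finiteIndex_comap_eq [IsFiniteMeasure μ]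
    (hμ : ∀ g, μ.map (fun x => (‖ρ g x‖⁻¹ : ℂ) • ρ g x) = μ) (hbot : μ ((⊥ : Submodule ℂ V) : Set V) = 0)
    (hW : ∃ W : Submodule ℂ V, W ≠ ⊤ ∧ μ W ≠ 0) :
    ∃ H : Subgroup G, H.FiniteIndex ∧ ∃ W : Submodule ℂ V, W ≠ ⊥ ∧ W ≠ ⊤ ∧
      ∀ h ∈ H, ∀ v ∈ W, ρ h v ∈ W := by
  classical
  have hex : ∃ m : ℕ, ∃ W : Submodule ℂ V, Module.finrank ℂ W = m ∧ W ≠ ⊤ ∧ μ W ≠ 0 := by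
    obtain ⟨W, h⟩ := hW
    exact ⟨_, W, rfl, h⟩
  obtain ⟨W, hWm, hWt, hW0⟩ := Nat.find_spec hex
  have hfin := finite_setOf_measure_submodule (μ := μ) (m := Nat.find hex) (fun W' hW' => by
    by_contra h0
    refine Nat.find_min hex hW' ⟨W', rfl, ?_, h0⟩
    rintro rfl
    rw [← hWm] at hW'
    exact absurd (Submodule.finrank_le W) (by rw [finrank_top] at hW'; omega))
    (pos_iff_ne_zero.2 hW0)
  have hcomp : ∀ g h, (W.comap (ρ g : V →ₗ[ℂ] V)).comap (ρ h : V →ₗ[ℂ] V) =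
      W.comap (ρ (g * h) : V →ₗ[ℂ] V) := fun g h => by rw [map_mul]; rfl
  have hone : W.comap (ρ 1 : V →ₗ[ℂ] V) = W := by rw [map_one]; rfl
  let H : Subgroup G :=
    { carrier := {g | W.comap (ρ g : V →ₗ[ℂ] V) = W}
      mul_mem' := fun {a b} ha hb => by
        change W.comap _ = W at ha hb
        change W.comap _ = W
        rw [← hcomp, ha, hb]
      one_mem' := hone
      inv_mem' := fun {a} ha => by
        change W.comap _ = W at ha
        change W.comap _ = W
        conv_lhs => rw [← ha]
        rw [hcomp, mul_inv_cancel, hone] }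
  refine ⟨H, Subgroup.finiteIndex_of_finite_range
    (f := fun g => W.comap (ρ g⁻¹ : V →ₗ[ℂ] V)) (hfin.subset ?_) fun a b hab => ?_, W, ?_, hWt,
    fun h hh v hv => ?_⟩
  · rintro _ ⟨g, rfl⟩
    refine ⟨?_, (measure_comap_eq hμ W g⁻¹).ge⟩
    have hinv : ∀ g : G, (ρ g : V →ₗ[ℂ] V) ∘ₗ (ρ g⁻¹ : V →ₗ[ℂ] V) = LinearMap.id := fun g => by
      ext v
      have : (ρ (g * g⁻¹)) v = v := by simp
      rwa [map_mul] at this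
    let e : V ≃ₗ[ℂ] V := LinearEquiv.ofLinearMap (ρ g⁻¹ : V →ₗ[ℂ] V) (ρ g : V →ₗ[ℂ] V)
      (by simpa using hinv g⁻¹) (hinv g)
    have : W.comap (ρ g⁻¹ : V →ₗ[ℂ] V) = W.map (e.symm : V →ₗ[ℂ] V) :=
      (Submodule.map_equiv_eq_comap_symm e.symm W).symm
    change Module.finrank ℂ (W.comap (ρ g⁻¹ : V →ₗ[ℂ] V)) = _
    rw [this, ← hWm]
    exact LinearEquiv.finrank_map_eq e.symm W
  · change W.comap (ρ (a⁻¹ * b) : V →ₗ[ℂ] V) = W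
    rw [← hcomp]
    rw [show W.comap (ρ a⁻¹ : V →ₗ[ℂ] V) = W.comap (ρ b⁻¹ : V →ₗ[ℂ] V) from hab, hcomp, inv_mul_cancel, hone]
  · rintro rfl
    exact hW0 hbot
  · have : v ∈ W.comap (ρ h : V →ₗ[ℂ] V) := by rwa [show W.comap (ρ h : V →ₗ[ℂ] V) = W from hh]
    exact this

end ProjectiveMeasure

section BoundedDistortion

open scoped Topology
open MeasureTheory Filter

theorem exists_norm_mul_norm_inv_le {G V : Type*} [Group G] [NormedAddCommGroup V]
    [NormedSpace ℂ V] [FiniteDimensional ℂ V] [MeasurableSpace V] [BorelSpace V] [Nontrivial V]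
    {μ : Measure V} [IsProbabilityMeasure μ] {ρ : G →* (V →L[ℂ] V)}
    (hμ1 : ∀ᵐ x ∂μ, ‖x‖ = 1)
    (hμ : ∀ g, μ.map (fun x => (‖ρ g x‖⁻¹ : ℂ) • ρ g x) = μ)
    (h0 : ∀ W : Submodule ℂ V, W ≠ ⊤ → μ W = 0) :
    ∃ K : ℝ, ∀ g, ‖ρ g‖ * ‖ρ g⁻¹‖ ≤ K := by
  by_contra! hK
  choose g hg using fun k : ℕ => hK k
  have hne : ∀ k, ‖ρ (g k)‖ ≠ 0 := fun k h => by
    have := hg k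
    rw [h, zero_mul] at this
    exact absurd this (by simp)
  have hneC : ∀ k, (‖ρ (g k)‖ : ℂ) ≠ 0 := fun k => by exact_mod_cast hne k
  let A : ℕ → V →L[ℂ] V := fun k => (‖ρ (g k)‖⁻¹ : ℂ) • ρ (g k)
  have hA1 : ∀ k, A k ∈ Metric.sphere (0 : V →L[ℂ] V) 1 := fun k => by
    rw [mem_sphere_zero_iff_norm, norm_smul]
    simp [hne k]
  have hproper : ProperSpace (V →L[ℂ] V) := FiniteDimensional.proper ℂ _
  obtain ⟨B, hB1, φ, hφ, hlim⟩ := (isCompact_sphere (0 : V →L[ℂ] V) 1).tendsto_subseq hA1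
  rw [mem_sphere_zero_iff_norm] at hB1
  have hBunit : ¬ IsUnit B := by
    rintro ⟨u, hu⟩
    have h1 : Tendsto (fun k => ‖Ring.inverse (A (φ k))‖) atTop (𝓝 ‖Ring.inverse B‖) := by
      rw [← hu] at hlim ⊢
      exact ((NormedRing.inverse_continuousAt u).tendsto.comp hlim).norm
    have h2 : ∀ k, Ring.inverse (A k) = (‖ρ (g k)‖ : ℂ) • ρ (g k)⁻¹ := fun k => by
      have e1 : A k * ((‖ρ (g k)‖ : ℂ) • ρ (g k)⁻¹) = 1 := by
        simp only [A]
        rw [smul_mul_smul_comm, ← map_mul, mul_inv_cancel, map_one, inv_mul_cancel₀ (hneC k),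
          one_smul]
      have e2 : ((‖ρ (g k)‖ : ℂ) • ρ (g k)⁻¹) * A k = 1 := by
        simp only [A]
        rw [smul_mul_smul_comm, ← map_mul, inv_mul_cancel, map_one, mul_inv_cancel₀ (hneC k),
          one_smul]
      exact Ring.inverse_unit ⟨A k, _, e1, e2⟩
    have h3 : Tendsto (fun k => ‖Ring.inverse (A (φ k))‖) atTop atTop := by
      refine tendsto_atTop_mono (fun k => ?_) (tendsto_natCast_atTop_atTop.comp hφ.tendsto_atTop)
      rw [h2, norm_smul]
      simpa using (hg (φ k)).le
    exact not_tendsto_nhds_of_tendsto_atTop h3 _ h1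
  have hrange : (B : V →ₗ[ℂ] V).range ≠ ⊤ := fun h => hBunit <| by
    rw [ContinuousLinearMap.isUnit_iff_bijective]
    have hs : Function.Surjective (B : V →ₗ[ℂ] V) := LinearMap.range_eq_top.1 h
    exact ⟨LinearMap.injective_iff_surjective.2 hs, hs⟩
  have hker : (B : V →ₗ[ℂ] V).ker ≠ ⊤ := fun h => by
    have : B = 0 := by
      ext v
      have : v ∈ (B : V →ₗ[ℂ] V).ker := h ▸ Submodule.mem_top
      exact this
    simp [this] at hB1
  set R : Submodule ℂ V := (B : V →ₗ[ℂ] V).range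
  have hR0 : (R : Set V).Nonempty := ⟨0, R.zero_mem⟩
  let f : V → ℝ := fun x => Metric.infDist x R
  have hfc : Continuous f := Metric.continuous_infDist_pt _
  have hfle : ∀ x, f x ≤ ‖x‖ := fun x => by
    simpa using Metric.infDist_le_dist_of_mem (x := x) R.zero_mem
  let T : ℕ → V → V := fun k x => (‖ρ (g (φ k)) x‖⁻¹ : ℂ) • ρ (g (φ k)) x
  have hTnorm : ∀ k x, ‖T k x‖ ≤ 1 := fun k x => by
    simp only [T, norm_smul, norm_inv, Complex.norm_real, norm_norm]
    exact inv_mul_le_one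
  have hTA : ∀ k x, T k x = (‖A (φ k) x‖⁻¹ : ℂ) • A (φ k) x := fun k x => by
    have := hneC (φ k)
    simp only [T, A, smul_apply, norm_smul, smul_smul, norm_inv,
      Complex.norm_real, norm_norm]
    congr 1
    push_cast
    field_simp
  have h_int : ∀ k, ∫ x, f (T k x) ∂μ = ∫ x, f x ∂μ := fun k => by
    conv_rhs => rw [← hμ (g (φ k))]
    rw [integral_map (by fun_prop) hfc.aestronglyMeasurable]
  have hlimint : Tendsto (fun k => ∫ x, f (T k x) ∂μ) atTop (𝓝 (∫ _, (0 : ℝ) ∂μ)) := by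
    refine tendsto_integral_of_dominated_convergence (fun _ => 1) (fun k => ?_)
      (integrable_const _) (fun k => ?_) ?_
    · exact (hfc.measurable.comp (by fun_prop)).aestronglyMeasurable
    · refine Eventually.of_forall fun x => ?_
      rw [Real.norm_of_nonneg Metric.infDist_nonneg]
      exact (hfle _).trans (hTnorm k x)
    · have : ∀ᵐ x ∂μ, x ∉ (B : V →ₗ[ℂ] V).ker := measure_eq_zero_iff_ae_notMem.1 (h0 _ hker)
      filter_upwards [this] with x hx
      have hBx : B x ≠ 0 := hx
      have hBxC : (‖B x‖ : ℂ) ≠ 0 := by exact_mod_cast norm_ne_zero_iff.2 hBx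
      have hAx : Tendsto (fun k => A (φ k) x) atTop (𝓝 (B x)) :=
        ((ContinuousLinearMap.apply ℂ V x).continuous.tendsto B).comp hlim
      have hTx : Tendsto (fun k => T k x) atTop (𝓝 ((‖B x‖⁻¹ : ℂ) • B x)) := by
        simp only [hTA]
        exact (((Complex.continuous_ofReal.tendsto _).comp hAx.norm).inv₀ hBxC).smul hAx
      have hfx : f ((‖B x‖⁻¹ : ℂ) • B x) = 0 :=
        Metric.infDist_zero_of_mem (R.smul_mem _ ⟨x, rfl⟩)
      rw [← hfx]
      exact (hfc.tendsto _).comp hTx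
  simp only [h_int, integral_zero] at hlimint
  have hzero : ∫ x, f x ∂μ = 0 := tendsto_nhds_unique tendsto_const_nhds hlimint
  have hfint : Integrable f μ := by
    refine Integrable.mono' (integrable_const (1 : ℝ)) hfc.aestronglyMeasurable ?_
    filter_upwards [hμ1] with x hx
    rw [Real.norm_of_nonneg Metric.infDist_nonneg, ← hx]
    exact hfle x
  have hae := (integral_eq_zero_iff_of_nonneg (fun x => Metric.infDist_nonneg) hfint).1 hzero
  have hmem : ∀ᵐ x ∂μ, x ∈ (R : Set V) := by
    filter_upwards [hae] with x hx
    exact (R.closed_of_finiteDimensional.mem_iff_infDist_zero hR0).2 hx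
  have hnot : ∀ᵐ x ∂μ, x ∉ (R : Set V) := measure_eq_zero_iff_ae_notMem.1 (h0 R hrange)
  obtain ⟨x, h1, h2⟩ := (hmem.and hnot).exists
  exact h2 h1

end BoundedDistortion

section SmallCommutators

open scoped Pointwise

section NormedRing

variable {R : Type*} [NormedRing R]

theorem norm_commutator_sub_one_le_of_mul_eq_one [NormOneClass R] {a a' b b' : R} (ha : a * a' = 1) (ha' : a' * a = 1)
    (hb : b * b' = 1) (hb' : b' * b = 1) (h1 : ‖a - 1‖ ≤ 1 / 2) (h2 : ‖b - 1‖ ≤ 1 / 2) :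
    ‖a * b * a' * b' - 1‖ ≤ 8 * ‖b - 1‖ * ‖a - 1‖ := by
  have hinv : ∀ {x y : R}, y * x = 1 → ‖x - 1‖ ≤ 1 / 2 → ‖y‖ ≤ 2 := by
    intro x y hyx hx
    have h : y = 1 - y * (x - 1) := by rw [mul_sub, hyx]; noncomm_ring
    have h3 : ‖y‖ ≤ ‖(1 : R)‖ + ‖y * (x - 1)‖ := by
      conv_lhs => rw [h]
      exact norm_sub_le _ _
    have h4 := norm_mul_le y (x - 1)
    rw [norm_one] at h3
    nlinarith [norm_nonneg y]
  have hA := hinv ha' h1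
  have hB := hinv hb' h2
  have e : a * b * a' * b' - 1 = ((a - 1) * (b - 1) - (b - 1) * (a - 1)) * a' * b' := by
    have : (a - 1) * (b - 1) - (b - 1) * (a - 1) = a * b - b * a := by noncomm_ring
    rw [this, sub_mul, sub_mul, mul_assoc b a a', ha, mul_one, hb]
  have hc : ‖(a - 1) * (b - 1) - (b - 1) * (a - 1)‖ ≤ 2 * (‖b - 1‖ * ‖a - 1‖) := by
    refine (norm_sub_le _ _).trans ?_
    have h5 := norm_mul_le (a - 1) (b - 1)
    have h6 := norm_mul_le (b - 1) (a - 1)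
    linarith [mul_comm ‖a - 1‖ ‖b - 1‖]
  rw [e]
  calc _ ≤ ‖(a - 1) * (b - 1) - (b - 1) * (a - 1)‖ * ‖a'‖ * ‖b'‖ := norm_mul₃_le
    _ ≤ 2 * (‖b - 1‖ * ‖a - 1‖) * 2 * 2 := by gcongr
    _ = _ := by ring

theorem norm_pow_sub_one_le {u : R} {n : ℕ} (h : 2 * n * ‖u - 1‖ ≤ 1) :
    ‖u ^ n - 1‖ ≤ 2 * n * ‖u - 1‖ := by
  induction n with
  | zero => simp
  | succ n ih =>
    push_cast at h ⊢
    have h0 := norm_nonneg (u - 1)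
    have h1 := ih (by linarith)
    have e : u ^ (n + 1) - 1 = (u ^ n - 1) * (u - 1) + (u - 1) + (u ^ n - 1) := by
      rw [pow_succ]; noncomm_ring
    have h2 : ‖u ^ (n + 1) - 1‖ ≤ ‖u ^ n - 1‖ * ‖u - 1‖ + ‖u - 1‖ + ‖u ^ n - 1‖ := by
      rw [e]
      refine (norm_add₃_le).trans ?_
      gcongr
      exact norm_mul_le _ _
    nlinarith

theorem le_norm_pow_sub_one [NormedAlgebra ℂ R] {u : R} {n : ℕ} (hn : 1 ≤ n) (h : 4 * n * ‖u - 1‖ ≤ 1) :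
    ‖u - 1‖ / 2 ≤ ‖u ^ n - 1‖ := by
  have h0 := norm_nonneg (u - 1)
  have key : ∀ m : ℕ, m ≤ n → ‖u ^ m - 1 - m * (u - 1)‖ ≤ m * (‖u - 1‖ / 2) := by
    intro m
    induction m with
    | zero => simp
    | succ m ih =>
      intro hm
      have hmn : (m : ℝ) ≤ n := by exact_mod_cast (Nat.le_succ m).trans hm
      have h1 : 4 * m * ‖u - 1‖ ≤ 1 := le_trans (by gcongr) h
      have h2 := norm_pow_sub_one_le (u := u) (n := m) (by linarith)
      have e : u ^ (m + 1) - 1 - ((m + 1 : ℕ) : R) * (u - 1) =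
          (u ^ m - 1) * (u - 1) + (u ^ m - 1 - m * (u - 1)) := by
        push_cast; rw [pow_succ]; noncomm_ring
      rw [e]
      refine (norm_add_le _ _).trans ?_
      have h3 := norm_mul_le (u ^ m - 1) (u - 1)
      have h4 := ih ((Nat.le_succ m).trans hm)
      push_cast
      nlinarith
  have h1 := key n le_rfl
  have h2 : ‖(n : R) * (u - 1)‖ ≤ ‖u ^ n - 1‖ + ‖u ^ n - 1 - n * (u - 1)‖ := by
    have : (n : R) * (u - 1) = (u ^ n - 1) - (u ^ n - 1 - n * (u - 1)) := by noncomm_ring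
    conv_lhs => rw [this]
    exact norm_sub_le _ _
  have h3 : ‖(n : R) * (u - 1)‖ = n * ‖u - 1‖ := by
    rw [← nsmul_eq_mul, ← Nat.cast_smul_eq_nsmul ℂ, norm_smul, Complex.norm_natCast]
  have h4 : (1 : ℝ) ≤ n := by exact_mod_cast hn
  nlinarith

end NormedRing

/-- The product `h 0 ^ a₀ * h 1 ^ a₁ * ⋯` with exponents taken from a list. -/
def powWord {G : Type*} [Group G] : (ℕ → G) → List ℕ → G
  | _, [] => 1
  | h, a :: l => h 0 ^ a * powWord (fun k => h (k + 1)) l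

theorem powWord_mem_pow {G : Type*} [Group G] {T : Set G} (h1 : 1 ∈ T) {Q : ℕ} (l : List ℕ)
    (hl : ∀ a ∈ l, a ≤ Q) {L : ℕ} {h : ℕ → G} (hh : ∀ k, h k ∈ T ^ (L * 4 ^ k)) :
    powWord h l ∈ T ^ (Q * L * 5 ^ l.length) := by
  induction l generalizing h L with
  | nil => exact Set.pow_subset_pow_right h1 (Nat.zero_le _) (by simp [powWord])
  | cons a l ih =>
    have e1 := ih (fun b hb => hl b (by simp [hb])) (L := 4 * L) (h := fun k => h (k + 1))
      (fun k => by
        have := hh (k + 1)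
        rwa [show L * 4 ^ (k + 1) = 4 * L * 4 ^ k by ring] at this)
    have e2 : h 0 ^ a ∈ T ^ (L * Q) := by
      have h3 : h 0 ^ a ∈ (T ^ L) ^ a := Set.pow_mem_pow (by simpa using hh 0)
      rw [← pow_mul] at h3
      exact Set.pow_subset_pow_right h1 (Nat.mul_le_mul_left _ (hl a (by simp))) h3
    refine Set.pow_subset_pow_right h1 ?_ (pow_add T _ _ ▸ Set.mul_mem_mul e2 e1)
    rw [List.length_cons, pow_succ]
    have : 1 ≤ 5 ^ l.length := Nat.one_le_pow _ _ (by norm_num)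
    nlinarith [Nat.zero_le (Q * L)]

variable {G R : Type*} [Group G] [NormedRing R] [NormOneClass R] {ρ : G →* R} {Q : ℕ}

theorem norm_powWord_sub_one_le (hQ : 1 ≤ Q) (l : List ℕ) (hl : ∀ a ∈ l, a < Q) {h : ℕ → G}
    (h0 : 4 * Q * ‖ρ (h 0) - 1‖ ≤ 1)
    (hs : ∀ k, 32 * Q * ‖ρ (h (k + 1)) - 1‖ ≤ ‖ρ (h k) - 1‖) :
    ‖ρ (powWord h l) - 1‖ ≤ 4 * Q * ‖ρ (h 0) - 1‖ := by
  have hQ1 : (1 : ℝ) ≤ Q := by exact_mod_cast hQ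
  induction l generalizing h with
  | nil => simpa [powWord] using by positivity
  | cons a l ih =>
    have hs0 := hs 0
    have hn0 := norm_nonneg (ρ (h 0) - 1)
    have hn1 := norm_nonneg (ρ (h (0 + 1)) - 1)
    have ih := ih (fun b hb => hl b (by simp [hb])) (h := fun k => h (k + 1))
      (by nlinarith) (fun k => hs (k + 1))
    have haQ : (a : ℝ) ≤ Q := by exact_mod_cast (hl a (by simp)).le
    have hp : ‖ρ (h 0) ^ a - 1‖ ≤ 2 * Q * ‖ρ (h 0) - 1‖ :=
      (norm_pow_sub_one_le (by nlinarith)).trans (by gcongr)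
    have hp1 : ‖ρ (h 0) ^ a‖ ≤ 2 := by
      have := norm_add_le (ρ (h 0) ^ a - 1) 1
      rw [sub_add_cancel, norm_one] at this
      linarith
    set w := powWord (fun k => h (k + 1)) l
    have e : ρ (powWord h (a :: l)) - 1 = ρ (h 0) ^ a * (ρ w - 1) + (ρ (h 0) ^ a - 1) := by
      rw [powWord, map_mul, map_pow]; noncomm_ring
    rw [e]
    refine (norm_add_le _ _).trans ?_
    have h3 := norm_mul_le (ρ (h 0) ^ a) (ρ w - 1)
    have h4 : ‖ρ (h 0) ^ a‖ * ‖ρ w - 1‖ ≤ 2 * ‖ρ w - 1‖ := by gcongr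
    nlinarith

theorem powWord_injective [NormedAlgebra ℂ R] (hQ : 1 ≤ Q) {l l' : List ℕ}
    (hlen : l.length = l'.length) (hl : ∀ a ∈ l, a < Q) (hl' : ∀ a ∈ l', a < Q) {h : ℕ → G}
    (h0 : 4 * Q * ‖ρ (h 0) - 1‖ ≤ 1) (hpos : ∀ k, ρ (h k) ≠ 1)
    (hs : ∀ k, 32 * Q * ‖ρ (h (k + 1)) - 1‖ ≤ ‖ρ (h k) - 1‖)
    (heq : powWord h l = powWord h l') : l = l' := by
  have hQ1 : (1 : ℝ) ≤ Q := by exact_mod_cast hQ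
  induction l generalizing h l' with
  | nil => exact (List.length_eq_zero_iff.1 hlen.symm).symm
  | cons a l ih =>
    obtain _ | ⟨b, l'⟩ := l'
    · simp at hlen
    have hs0 := hs 0
    have hn0 : 0 < ‖ρ (h 0) - 1‖ := norm_pos_iff.2 (sub_ne_zero.2 (hpos 0))
    have hn1 := norm_nonneg (ρ (h (0 + 1)) - 1)
    have hh1 : 4 * Q * ‖ρ (h (0 + 1)) - 1‖ ≤ 1 := by nlinarith
    have hlt : ∀ a ∈ l, a < Q := fun b hb => hl b (by simp [hb])
    have hlt' : ∀ a ∈ l', a < Q := fun b hb => hl' b (by simp [hb])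
    have hw : ∀ m : List ℕ, (∀ a ∈ m, a < Q) →
        ‖ρ (powWord (fun k => h (k + 1)) m) - 1‖ ≤ 4 * Q * ‖ρ (h (0 + 1)) - 1‖ := fun m hm =>
      norm_powWord_sub_one_le (h := fun k => h (k + 1)) hQ m hm hh1 (fun k => hs (k + 1))
    have hne : ∀ (c d : ℕ) (m m' : List ℕ), (∀ a ∈ m, a < Q) → (∀ a ∈ m', a < Q) → c < d →
        d < Q → h 0 ^ c * powWord (fun k => h (k + 1)) m ≠
          h 0 ^ d * powWord (fun k => h (k + 1)) m' := by
      intro c d m m' hm hm' hcd hd heq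
      obtain ⟨e, rfl⟩ := Nat.exists_eq_add_of_lt hcd
      rw [add_assoc, pow_add, mul_assoc, mul_right_inj] at heq
      have heQ : ((e + 1 : ℕ) : ℝ) ≤ Q := by exact_mod_cast (by omega : e + 1 ≤ Q)
      set u := ρ (h 0) ^ (e + 1)
      set w := powWord (fun k => h (k + 1)) m
      set w' := powWord (fun k => h (k + 1)) m'
      have hlow : ‖ρ (h 0) - 1‖ / 2 ≤ ‖u - 1‖ :=
        le_norm_pow_sub_one (by omega) (le_trans (by gcongr) h0)
      have hup : ‖u - 1‖ ≤ 2 * Q * ‖ρ (h 0) - 1‖ :=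
        (norm_pow_sub_one_le (le_trans (by gcongr; norm_num) h0)).trans (by gcongr)
      have hu : ‖u‖ ≤ 2 := by
        have := norm_add_le (u - 1) 1
        rw [sub_add_cancel, norm_one] at this
        linarith
      have heq' : ρ w = u * ρ w' := by rw [heq, map_mul, map_pow]
      have e1 : u - 1 = (ρ w - 1) - u * (ρ w' - 1) := by rw [heq']; noncomm_ring
      have e2 : ‖u - 1‖ ≤ ‖ρ w - 1‖ + ‖u‖ * ‖ρ w' - 1‖ := by
        conv_lhs => rw [e1]
        exact (norm_sub_le _ _).trans (by gcongr; exact norm_mul_le _ _)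
      have e3 : ‖u‖ * ‖ρ w' - 1‖ ≤ 2 * ‖ρ w' - 1‖ := by gcongr
      have e4 := hw m hm
      have e5 := hw m' hm'
      linarith
    simp only [powWord] at heq
    rcases lt_trichotomy a b with hab | rfl | hab
    · exact absurd heq (hne a b l l' hlt hlt' hab (hl' b (by simp)))
    · congr 1
      rw [mul_right_inj] at heq
      exact ih (by simpa using hlen) hlt hlt' (h := fun k => h (k + 1)) hh1
        (fun k => hpos (k + 1)) (fun k => hs (k + 1)) heq
    · exact absurd heq.symm (hne b a l' l hlt' hlt hab (hl a (by simp)))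

theorem HasGrowthDegree.false_of_small_sequence [NormedAlgebra ℂ R] {d : ℕ}
    (hd : HasGrowthDegree G d) {T : Set G} (hT : T.Finite) (h1 : 1 ∈ T) (hQ : Q = 2 * 5 ^ d)
    {L : ℕ} {h : ℕ → G} (hh : ∀ k, h k ∈ T ^ (L * 4 ^ k))
    (h0 : 4 * Q * ‖ρ (h 0) - 1‖ ≤ 1) (hpos : ∀ k, ρ (h k) ≠ 1)
    (hs : ∀ k, 32 * Q * ‖ρ (h (k + 1)) - 1‖ ≤ ‖ρ (h k) - 1‖) : False := by
  have hQ1 : 1 ≤ Q := by rw [hQ]; have := Nat.one_le_pow d 5 (by norm_num); omega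
  obtain ⟨C, hC⟩ := hd.card_le hT
  obtain ⟨m, hm⟩ := pow_unbounded_of_one_lt (C * (Q * L + 1) ^ d) (one_lt_two)
  have key := hC (Q * L * 5 ^ m) (Fin m → Fin Q)
    (fun f => powWord h (List.ofFn fun i => (f i : ℕ)))
    (fun f f' hf => by
      have := powWord_injective hQ1 (by simp) (by simp)
        (by simp) h0 hpos hs hf
      funext i
      exact Fin.ext (congrFun (List.ofFn_injective this) i))
    (fun f => by
      have := powWord_mem_pow (T := T) h1 (Q := Q) (List.ofFn fun i => (f i : ℕ))
        (by simp only [List.forall_mem_ofFn_iff]; exact fun i => (f i).2.le) hh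
      rwa [List.length_ofFn] at this)
  have h5 : 1 ≤ 5 ^ m := Nat.one_le_pow _ _ (by norm_num)
  have hle : C * (Q * L * 5 ^ m + 1) ^ d ≤ C * (Q * L + 1) ^ d * (5 ^ m) ^ d := by
    rw [mul_assoc C, ← mul_pow]
    gcongr
    rw [add_mul, one_mul]
    omega
  have hcard : Fintype.card (Fin m → Fin Q) = 2 ^ m * (5 ^ m) ^ d := by
    simp only [Fintype.card_fun, Fintype.card_fin]
    rw [hQ, mul_pow, ← pow_mul, ← pow_mul, mul_comm d m]
  rw [hcard] at key
  have hpos5 : 0 < (5 ^ m) ^ d := by positivity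
  exact absurd (Nat.le_of_mul_le_mul_right (key.trans hle) hpos5) (not_le.2 hm)

end SmallCommutators

section NearScalar

open scoped Pointwise Topology commutatorElement

variable {G V : Type*} [Group G] [NormedAddCommGroup V] [NormedSpace ℂ V]

/-- The elements of `G` which act, up to rescaling, within `ε` of the identity. -/
def nearScalar (ρ : G →* (V →L[ℂ] V)) (ε : ℝ) : Set G :=
  {g | ∃ c : ℂ, c ≠ 0 ∧ ‖c • ρ g - 1‖ ≤ ε}

variable {ρ : G →* (V →L[ℂ] V)}

theorem map_ne_zero_of_nontrivial [Nontrivial V] (g : G) : ρ g ≠ 0 := fun h => by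
  have h1 : ρ (g * g⁻¹) = 0 := by rw [map_mul, h, zero_mul]
  rw [mul_inv_cancel, map_one] at h1
  exact one_ne_zero h1

theorem commute_of_mem_closure {E : Set G} {a : V →L[ℂ] V} (h : ∀ t ∈ E, a * ρ t = ρ t * a)
    {g : G} (hg : g ∈ Subgroup.closure E) : a * ρ g = ρ g * a := by
  induction hg using Subgroup.closure_induction with
  | mem x hx => exact h x hx
  | one => simp
  | mul x y _ _ hx hy => rw [map_mul, ← mul_assoc, hx, mul_assoc, hy, mul_assoc]
  | inv x _ hx =>
    have h1 : ρ x * ρ x⁻¹ = 1 := by rw [← map_mul, mul_inv_cancel, map_one]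
    have h2 : ρ x⁻¹ * ρ x = 1 := by rw [← map_mul, inv_mul_cancel, map_one]
    calc a * ρ x⁻¹ = ρ x⁻¹ * (ρ x * a) * ρ x⁻¹ := by rw [← mul_assoc, h2, one_mul]
      _ = ρ x⁻¹ * a := by rw [← hx, mul_assoc, mul_assoc, h1, mul_one]

theorem exists_nearScalar_ne_smul_one (hV : 1 < Module.finrank ℂ V) {E : Set G}
    (hirr : ¬ ∃ W : Submodule ℂ V, W ≠ ⊥ ∧ W ≠ ⊤ ∧
      ∀ h ∈ Subgroup.closure E, ∀ v ∈ W, ρ h v ∈ W) :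
    ∃ g ∈ E, ∀ c : ℂ, ρ g ≠ c • 1 := by
  by_contra! h
  have : Nontrivial V := Module.nontrivial_of_finrank_pos (R := ℂ) (by omega)
  obtain ⟨v, hv⟩ := exists_ne (0 : V)
  have hscalar : ∀ g ∈ Subgroup.closure E, ∃ c : ℂ, ρ g = c • 1 := by
    intro g hg
    induction hg using Subgroup.closure_induction with
    | mem x hx => exact h x hx
    | one => exact ⟨1, by simp⟩
    | mul x y _ _ hx hy =>
      obtain ⟨c, hc⟩ := hx
      obtain ⟨c', hc'⟩ := hy
      exact ⟨c * c', by rw [map_mul, hc, hc', smul_mul_smul_comm, one_mul]⟩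
    | inv x _ hx =>
      obtain ⟨c, hc⟩ := hx
      have hc0 : c ≠ 0 := by
        rintro rfl
        exact map_ne_zero_of_nontrivial x (hc.trans (zero_smul _ _))
      have h1 : c • ρ x⁻¹ = 1 := by
        rw [← one_mul (ρ x⁻¹), ← smul_mul_assoc, ← hc, ← map_mul, mul_inv_cancel, map_one]
      exact ⟨c⁻¹, by rw [← h1, inv_smul_smul₀ hc0]⟩
  refine hirr ⟨Submodule.span ℂ {v}, by simpa using hv, fun htop => ?_, fun g hg w hw => ?_⟩
  · have h1 := finrank_span_singleton (K := ℂ) hv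
    rw [htop, finrank_top] at h1
    omega
  · obtain ⟨c, hc⟩ := hscalar g hg
    rw [hc]
    exact Submodule.smul_mem _ c hw

variable [FiniteDimensional ℂ V]

theorem closure_nearScalar_finiteIndex [Nontrivial V] {K : ℝ}
    (hK : ∀ g, ‖ρ g‖ * ‖ρ g⁻¹‖ ≤ K) {ε : ℝ} (hε : 0 < ε) :
    (Subgroup.closure (nearScalar ρ ε)).FiniteIndex := by
  have hne : ∀ g, ‖ρ g‖ ≠ 0 := fun g => norm_ne_zero_iff.2 (map_ne_zero_of_nontrivial g)
  have hneC : ∀ g, (‖ρ g‖ : ℂ) ≠ 0 := fun g => by exact_mod_cast hne g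
  have hK0 : 0 < K := (mul_pos (norm_pos_iff.2 (map_ne_zero_of_nontrivial 1))
    (norm_pos_iff.2 (map_ne_zero_of_nontrivial 1⁻¹))).trans_le (hK 1)
  have hproper : ProperSpace (V →L[ℂ] V) := FiniteDimensional.proper ℂ _
  obtain ⟨t, -, htfin, ht⟩ := (isCompact_sphere (0 : V →L[ℂ] V) 1).finite_cover_balls
    (show 0 < ε / (2 * K) by positivity)
  have hex : ∀ g, ∃ x ∈ t, ‖(‖ρ g‖⁻¹ : ℂ) • ρ g - x‖ < ε / (2 * K) := fun g => by
    have h1 : (‖ρ g‖⁻¹ : ℂ) • ρ g ∈ Metric.sphere (0 : V →L[ℂ] V) 1 := by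
      rw [mem_sphere_zero_iff_norm, norm_smul]
      simp [hne g]
    simpa [dist_eq_norm] using ht h1
  choose f hft hf using hex
  refine Subgroup.finiteIndex_of_finite_range (f := f)
    (htfin.subset (by rintro _ ⟨g, rfl⟩; exact hft g)) fun a b hab => Subgroup.subset_closure ?_
  have hdist : ‖(‖ρ b‖⁻¹ : ℂ) • ρ b - (‖ρ a‖⁻¹ : ℂ) • ρ a‖ ≤ ε / K := by
    have h1 := hf a
    have h2 := hf b
    rw [← hab] at h2
    have h3 := norm_sub_le_norm_sub_add_norm_sub ((‖ρ b‖⁻¹ : ℂ) • ρ b) (f a)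
      ((‖ρ a‖⁻¹ : ℂ) • ρ a)
    rw [norm_sub_rev (f a)] at h3
    have h4 : ε / K = ε / (2 * K) + ε / (2 * K) := by field_simp; ring
    linarith
  refine ⟨‖ρ a‖ * (‖ρ b‖⁻¹ : ℂ), mul_ne_zero (hneC a) (inv_ne_zero (hneC b)), ?_⟩
  have e : ((‖ρ a‖ : ℂ) * (‖ρ b‖⁻¹ : ℂ)) • ρ (a⁻¹ * b) - 1 =
      ((‖ρ a‖ : ℂ) • ρ a⁻¹) * ((‖ρ b‖⁻¹ : ℂ) • ρ b - (‖ρ a‖⁻¹ : ℂ) • ρ a) := by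
    rw [mul_sub, smul_mul_smul_comm, smul_mul_smul_comm, ← map_mul, ← map_mul, inv_mul_cancel,
      mul_inv_cancel₀ (hneC a), map_one, one_smul]
  rw [e]
  refine (norm_mul_le _ _).trans ?_
  have h5 : ‖(‖ρ a‖ : ℂ) • ρ a⁻¹‖ ≤ K := by
    rw [norm_smul]
    simpa using hK a
  calc _ ≤ K * (ε / K) := by gcongr
    _ = ε := by field_simp

theorem exists_finite_commute_imp (E : Set G) : ∃ F : Set G, F.Finite ∧ F ⊆ E ∧
    ∀ a : V →L[ℂ] V, (∀ t ∈ F, a * ρ t = ρ t * a) → ∀ t ∈ E, a * ρ t = ρ t * a := by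
  classical
  obtain ⟨s', hs', hspan⟩ := (Submodule.fg_span_iff_fg_span_finset_subset (R := ℂ) (ρ '' E)).1
    (IsNoetherian.noetherian _)
  obtain ⟨F, hF, rfl⟩ := Finset.subset_set_image_iff.1 hs'
  refine ⟨F, F.finite_toSet, hF, fun a ha t ht => ?_⟩
  have hmem : ρ t ∈ Submodule.span ℂ ((F.image ρ : Finset _) : Set (V →L[ℂ] V)) :=
    hspan ▸ Submodule.subset_span ⟨t, ht, rfl⟩
  generalize ρ t = b at hmem
  induction hmem using Submodule.span_induction with
  | mem x hx =>
    obtain ⟨t, ht, rfl⟩ := Finset.mem_image.1 (Finset.mem_coe.1 hx)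
    exact ha t ht
  | zero => simp
  | add x y _ _ hx hy => rw [mul_add, add_mul, hx, hy]
  | smul c x _ hx => rw [mul_smul_comm, smul_mul_assoc, hx]

theorem exists_smul_one_of_commute [Nontrivial V] {H : Subgroup G}
    (hirr : ¬ ∃ W : Submodule ℂ V, W ≠ ⊥ ∧ W ≠ ⊤ ∧ ∀ h ∈ H, ∀ v ∈ W, ρ h v ∈ W)
    {a : V →L[ℂ] V} (ha : ∀ h ∈ H, a * ρ h = ρ h * a) : ∃ c : ℂ, a = c • 1 := by
  obtain ⟨c, hc⟩ := Module.End.exists_eigenvalue (a : V →ₗ[ℂ] V)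
  refine ⟨c, ?_⟩
  by_contra hne
  refine hirr ⟨Module.End.eigenspace (a : V →ₗ[ℂ] V) c, hc, fun htop => hne ?_, fun h hh v hv => ?_⟩
  · ext v
    have : v ∈ Module.End.eigenspace (a : V →ₗ[ℂ] V) c := htop ▸ Submodule.mem_top
    simpa using Module.End.mem_eigenspace_iff.1 this
  · rw [Module.End.mem_eigenspace_iff] at *
    have h1 : a v = c • v := hv
    have h2 : a (ρ h v) = ρ h (a v) := congrArg (fun b : V →L[ℂ] V => b v) (ha h hh)
    rw [h1, map_smul] at h2
    exact h2

theorem exists_trace_ne_zero [Nontrivial V] : ∃ ε : ℝ, 0 < ε ∧ ∀ b : V →L[ℂ] V, ‖b - 1‖ ≤ ε →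
    LinearMap.trace ℂ V (b : V →ₗ[ℂ] V) ≠ 0 := by
  let f : (V →L[ℂ] V) →ₗ[ℂ] ℂ := LinearMap.trace ℂ V ∘ₗ ContinuousLinearMap.coeLM ℂ
  have hf : Continuous f := f.continuous_of_finiteDimensional
  have h1 : f 1 ≠ 0 := by
    have : f 1 = Module.finrank ℂ V := LinearMap.trace_one ℂ V
    rw [this]
    exact_mod_cast Module.finrank_pos.ne'
  obtain ⟨ε, hε, h⟩ := Metric.eventually_nhds_iff.1 (hf.continuousAt.eventually_ne h1)
  refine ⟨ε / 2, half_pos hε, fun b hb => ?_⟩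
  exact h (by rw [dist_eq_norm]; linarith)

theorem exists_commutator_ne_smul_one [Nontrivial V] {ε : ℝ} (hε : ε ≤ 1 / 2)
    (htr : ∀ b : V →L[ℂ] V, ‖b - 1‖ ≤ ε → LinearMap.trace ℂ V (b : V →ₗ[ℂ] V) ≠ 0)
    (hirr : ¬ ∃ W : Submodule ℂ V, W ≠ ⊥ ∧ W ≠ ⊤ ∧
      ∀ h ∈ Subgroup.closure (nearScalar ρ ε), ∀ v ∈ W, ρ h v ∈ W)
    {F : Set G} (hFE : F ⊆ nearScalar ρ ε)
    (hF : ∀ a : V →L[ℂ] V, (∀ t ∈ F, a * ρ t = ρ t * a) →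
      ∀ t ∈ nearScalar ρ ε, a * ρ t = ρ t * a)
    {g : G} (hg : ∀ c : ℂ, ρ g ≠ c • 1) {c : ℂ} (hc : c ≠ 0) (hgc : ‖c • ρ g - 1‖ ≤ ε) :
    ∃ t ∈ F, (∀ z : ℂ, ρ ⁅g, t⁆ ≠ z • 1) ∧ ‖ρ ⁅g, t⁆ - 1‖ ≤ 8 * ε * ‖c • ρ g - 1‖ := by
  have hex : ∃ t ∈ F, ρ g * ρ t ≠ ρ t * ρ g := by
    by_contra! h
    obtain ⟨c, hc⟩ := exists_smul_one_of_commute hirr fun h' hh => commute_of_mem_closure (hF _ h) hh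
    exact hg c hc
  obtain ⟨t, ht, hcomm⟩ := hex
  obtain ⟨e, he, hte⟩ := hFE ht
  have hinv : ∀ x : G, ρ x * ρ x⁻¹ = 1 := fun x => by rw [← map_mul, mul_inv_cancel, map_one]
  have hinv' : ∀ x : G, ρ x⁻¹ * ρ x = 1 := fun x => by rw [← map_mul, inv_mul_cancel, map_one]
  have hcm : ρ ⁅g, t⁆ = ρ g * ρ t * ρ g⁻¹ * ρ t⁻¹ := by
    simp only [commutatorElement_def, map_mul]
  refine ⟨t, ht, fun z hz => hcomm ?_, ?_⟩
  · have h1 : ρ g * ρ t * ρ g⁻¹ = z • ρ t := by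
      calc ρ g * ρ t * ρ g⁻¹ = ρ ⁅g, t⁆ * ρ t := by
            rw [hcm, mul_assoc _ (ρ t⁻¹), hinv', mul_one]
        _ = z • ρ t := by rw [hz, smul_mul_assoc, one_mul]
    have htr0 : LinearMap.trace ℂ V (ρ t : V →ₗ[ℂ] V) ≠ 0 := fun h0 => htr _ hte (by
      rw [ContinuousLinearMap.toLinearMap_smul, map_smul, h0, smul_zero])
    have h2 : LinearMap.trace ℂ V (ρ t : V →ₗ[ℂ] V) =
        z * LinearMap.trace ℂ V (ρ t : V →ₗ[ℂ] V) := by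
      have h3 := congrArg (fun b : V →L[ℂ] V => LinearMap.trace ℂ V (b : V →ₗ[ℂ] V)) h1
      simp only [ContinuousLinearMap.toLinearMap_smul, map_smul, smul_eq_mul] at h3
      rw [← h3]
      have h4 := LinearMap.trace_mul_comm ℂ (ρ g * ρ t : V →L[ℂ] V).toLinearMap
        (ρ g⁻¹ : V →L[ℂ] V).toLinearMap
      have h5 : ρ g⁻¹ * (ρ g * ρ t) = ρ t := by rw [← mul_assoc, hinv', one_mul]
      rw [← congrArg ContinuousLinearMap.toLinearMap h5]
      exact h4.symm
    have hz1 : z = 1 := by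
      have : (1 - z) * LinearMap.trace ℂ V (ρ t : V →ₗ[ℂ] V) = 0 := by linear_combination h2
      rcases mul_eq_zero.1 this with h | h
      · linear_combination -h
      · exact absurd h htr0
    rw [hz1, one_smul] at h1
    calc ρ g * ρ t = ρ g * ρ t * ρ g⁻¹ * ρ g := by rw [mul_assoc _ (ρ g⁻¹), hinv', mul_one]
      _ = ρ t * ρ g := by rw [h1]
  · have hscale : ∀ {x : ℂ} (u : G), x ≠ 0 → (x • ρ u) * (x⁻¹ • ρ u⁻¹) = 1 ∧
        (x⁻¹ • ρ u⁻¹) * (x • ρ u) = 1 := fun u hx => by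
      constructor
      · rw [smul_mul_smul_comm, mul_inv_cancel₀ hx, hinv, one_smul]
      · rw [smul_mul_smul_comm, inv_mul_cancel₀ hx, hinv', one_smul]
    have hmul : (c • ρ g) * (e • ρ t) * (c⁻¹ • ρ g⁻¹) * (e⁻¹ • ρ t⁻¹) = ρ ⁅g, t⁆ := by
      rw [smul_mul_smul_comm, smul_mul_smul_comm, smul_mul_smul_comm, hcm,
        show c * e * c⁻¹ * e⁻¹ = 1 by field_simp, one_smul]
    rw [← hmul]
    refine (norm_commutator_sub_one_le_of_mul_eq_one (hscale g hc).1 (hscale g hc).2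
      (hscale t he).1 (hscale t he).2 (hgc.trans hε) (hte.trans hε)).trans ?_
    gcongr

end NearScalar

section InvariantSubmodule

open scoped Pointwise commutatorElement
open MeasureTheory

theorem exists_invariant_submodule_of_norm_mul_norm_inv_le {G V : Type*} [Group G] {d : ℕ}
    (hd : HasGrowthDegree G d) [NormedAddCommGroup V] [NormedSpace ℂ V] [FiniteDimensional ℂ V]
    (ρ : G →* (V →L[ℂ] V)) (hV : 1 < Module.finrank ℂ V) {K : ℝ}
    (hK : ∀ g, ‖ρ g‖ * ‖ρ g⁻¹‖ ≤ K) :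
    ∃ H : Subgroup G, H.FiniteIndex ∧ ∃ W : Submodule ℂ V, W ≠ ⊥ ∧ W ≠ ⊤ ∧
      ∀ h ∈ H, ∀ v ∈ W, ρ h v ∈ W := by
  by_contra hcon
  have : Nontrivial V := Module.nontrivial_of_finrank_pos (R := ℂ) (by omega)
  obtain ⟨ε₀, hε₀, htr₀⟩ := exists_trace_ne_zero (V := V)
  obtain ⟨Q, hQ⟩ : ∃ Q : ℕ, Q = 2 * 5 ^ d := ⟨_, rfl⟩
  have hQ1 : (1 : ℝ) ≤ Q := by
    have : 1 ≤ Q := by rw [hQ]; have := Nat.one_le_pow d 5 (by norm_num); omega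
    exact_mod_cast this
  obtain ⟨ε, hε, hεε₀, hεQ⟩ : ∃ ε : ℝ, 0 < ε ∧ ε ≤ ε₀ ∧ 256 * Q * ε ≤ 1 :=
    ⟨min ε₀ (1 / (256 * Q)), by positivity, min_le_left _ _, by
      calc 256 * Q * min ε₀ (1 / (256 * Q)) ≤ 256 * Q * (1 / (256 * (Q : ℝ))) := by
            gcongr; exact min_le_right _ _
        _ = 1 := by field_simp⟩
  have hε2 : ε ≤ 1 / 2 := by nlinarith
  have htr := fun b hb => htr₀ b (le_trans hb hεε₀)
  have hirr : ¬ ∃ W : Submodule ℂ V, W ≠ ⊥ ∧ W ≠ ⊤ ∧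
      ∀ h ∈ Subgroup.closure (nearScalar ρ ε), ∀ v ∈ W, ρ h v ∈ W := fun h =>
    hcon ⟨_, closure_nearScalar_finiteIndex hK hε, h⟩
  obtain ⟨F, hFfin, hFE, hF⟩ := exists_finite_commute_imp (ρ := ρ) (nearScalar ρ ε)
  obtain ⟨g₀, ⟨c, hc, hgc⟩, hg₀⟩ := exists_nearScalar_ne_smul_one hV hirr
  obtain ⟨t₀, ht₀, hp, hpn⟩ := exists_commutator_ne_smul_one hε2 htr hirr hFE hF hg₀ hc hgc
  let P := {g : G // (∀ z : ℂ, ρ g ≠ z • 1) ∧ ‖ρ g - 1‖ ≤ ε}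
  have hshrink : ∀ {x : ℝ}, 0 ≤ x → x ≤ ε → 8 * ε * x ≤ ε := fun h0 h1 => by nlinarith
  have hstep : ∀ p : P, ∃ q : P, (∃ t ∈ F, q.1 = ⁅p.1, t⁆) ∧
      ‖ρ q.1 - 1‖ ≤ 8 * ε * ‖ρ p.1 - 1‖ := fun p => by
    obtain ⟨t, ht, h1, h2⟩ := exists_commutator_ne_smul_one hε2 htr hirr hFE hF p.2.1 one_ne_zero
      (by simpa using p.2.2)
    rw [one_smul] at h2
    exact ⟨⟨_, h1, h2.trans (hshrink (norm_nonneg _) p.2.2)⟩, ⟨t, ht, rfl⟩, h2⟩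
  choose next hnext hnorm using hstep
  let p₀ : P := ⟨⁅g₀, t₀⁆, hp, hpn.trans (hshrink (norm_nonneg _) hgc)⟩
  let T : Set G := {1, g₀, g₀⁻¹} ∪ (F ∪ F⁻¹)
  have hTfin : T.Finite := (Set.toFinite _).union (hFfin.union hFfin.inv)
  have h1T : (1 : G) ∈ T := Or.inl (by simp)
  have hTinv : T⁻¹ = T := by
    simp only [T, Set.union_inv, inv_inv, Set.inv_insert, Set.inv_singleton, inv_one]
    rw [Set.union_comm F⁻¹ F, Set.pair_comm g₀⁻¹ g₀]
  have hcomm : ∀ {n : ℕ} {g t : G}, g ∈ T ^ n → t ∈ T → ⁅g, t⁆ ∈ T ^ (n + 1 + n + 1) := by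
    intro n g t hg ht
    have hg' : g⁻¹ ∈ T ^ n := by
      rw [← hTinv, inv_pow, Set.inv_mem_inv]
      exact hg
    have ht' : t⁻¹ ∈ T := by
      rw [← hTinv, Set.inv_mem_inv]
      exact ht
    rw [commutatorElement_def, pow_succ, pow_add, pow_succ]
    exact Set.mul_mem_mul (Set.mul_mem_mul (Set.mul_mem_mul hg ht) hg') ht'
  have hmem : ∀ k, (next^[k] p₀).1 ∈ T ^ (4 * 4 ^ k) := by
    intro k
    induction k with
    | zero =>
      simpa using hcomm (n := 1) (g := g₀) (by rw [pow_one]; exact Or.inl (by simp))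
        (Or.inr (Or.inl ht₀))
    | succ k ih =>
      rw [Function.iterate_succ_apply']
      obtain ⟨t, ht, h⟩ := hnext (next^[k] p₀)
      rw [h]
      refine Set.pow_subset_pow_right h1T ?_ (hcomm ih (Or.inr (Or.inl ht)))
      have : 1 ≤ 4 ^ k := Nat.one_le_pow _ _ (by norm_num)
      rw [pow_succ]
      omega
  refine hd.false_of_small_sequence (ρ := ρ) hTfin h1T hQ (h := fun k => (next^[k] p₀).1) hmem
    ?_ (fun k h => ?_) fun k => ?_
  · have := p₀.2.2
    simp only [Function.iterate_zero, id_eq]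
    nlinarith
  · exact (next^[k] p₀).2.1 1 (by rw [h, one_smul])
  · simp only [Function.iterate_succ_apply']
    have := hnorm (next^[k] p₀)
    have h0 := norm_nonneg (ρ (next^[k] p₀).1 - 1)
    calc 32 * Q * ‖ρ (next (next^[k] p₀)).1 - 1‖
        ≤ 32 * Q * (8 * ε * ‖ρ (next^[k] p₀).1 - 1‖) := by gcongr
      _ = 256 * Q * ε * ‖ρ (next^[k] p₀).1 - 1‖ := by ring
      _ ≤ 1 * ‖ρ (next^[k] p₀).1 - 1‖ := by gcongr
      _ = _ := one_mul _

theorem exists_invariant_submodule_of_continuous {G V : Type*} [Group G] [Group.FG G] {d : ℕ}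
    (hd : HasGrowthDegree G d) [NormedAddCommGroup V] [NormedSpace ℂ V] [FiniteDimensional ℂ V]
    (ρ : G →* (V →L[ℂ] V)) (hV : 1 < Module.finrank ℂ V) :
    ∃ H : Subgroup G, H.FiniteIndex ∧ ∃ W : Submodule ℂ V, W ≠ ⊥ ∧ W ≠ ⊤ ∧
      ∀ h ∈ H, ∀ v ∈ W, ρ h v ∈ W := by
  have : Nontrivial V := Module.nontrivial_of_finrank_pos (R := ℂ) (by omega)
  borelize V
  obtain ⟨μ, hμ, hμ1, hinv⟩ := exists_invariant_measure_unit_sphere hd ρ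
  by_cases hW : ∃ W : Submodule ℂ V, W ≠ ⊤ ∧ μ W ≠ 0
  · refine exists_finiteIndex_comap_eq hinv (measure_eq_zero_iff_ae_notMem.2 ?_) hW
    filter_upwards [hμ1] with x hx h0
    rw [(Submodule.mem_bot ℂ).1 h0, norm_zero] at hx
    exact zero_ne_one hx
  · push Not at hW
    obtain ⟨K, hK⟩ := exists_norm_mul_norm_inv_le hμ1 hinv hW
    exact exists_invariant_submodule_of_norm_mul_norm_inv_le hd ρ hV hK

/-- A complex representation of dimension at least two of a group of polynomial growth becomes
reducible on a finite index subgroup. -/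
theorem exists_invariant_submodule {G V : Type*} [Group G] [Group.FG G] {d : ℕ}
    (hd : HasGrowthDegree G d) [AddCommGroup V] [Module ℂ V] [FiniteDimensional ℂ V]
    (ρ : Representation ℂ G V) (hV : 1 < Module.finrank ℂ V) :
    ∃ H : Subgroup G, H.FiniteIndex ∧ ∃ W : Submodule ℂ V, W ≠ ⊥ ∧ W ≠ ⊤ ∧
      ∀ h ∈ H, ∀ v ∈ W, ρ h v ∈ W := by
  let E := EuclideanSpace ℂ (Fin (Module.finrank ℂ V))
  let e : V ≃ₗ[ℂ] E := LinearEquiv.ofFinrankEq V E (by simp [E])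
  let ρ' : G →* (E →L[ℂ] E) :=
    { toFun := fun g => LinearMap.toContinuousLinearMap ((e : V →ₗ[ℂ] E) ∘ₗ ρ g ∘ₗ e.symm)
      map_one' := by ext1 x; simp
      map_mul' := fun g h => by ext1 x; simp }
  obtain ⟨H, hH, W, hbot, htop, hW⟩ :=
    exists_invariant_submodule_of_continuous hd ρ' (by simpa [E] using hV)
  refine ⟨H, hH, W.comap (e : V →ₗ[ℂ] E), fun h => hbot ?_, fun h => htop ?_, fun h hh v hv => ?_⟩
  · rw [← Submodule.map_comap_eq_of_surjective e.surjective W]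
    exact (congrArg _ h).trans (Submodule.map_bot _)
  · rw [← Submodule.map_comap_eq_of_surjective e.surjective W]
    exact (congrArg _ h).trans ((Submodule.map_top _).trans (LinearMap.range_eq_top.2 e.surjective))
  · have h1 := hW h hh (e v) hv
    have h2 : ρ' h (e v) = e (ρ h v) := by simp [ρ']
    rw [h2] at h1
    exact h1

end InvariantSubmodule

section Triangularization

open Module

theorem exists_common_eigenvector {G V : Type*} [Group G] [Group.FG G] {d : ℕ}
    (hd : HasGrowthDegree G d) [AddCommGroup V] [Module ℂ V] [FiniteDimensional ℂ V]
    [Nontrivial V] (ρ : Representation ℂ G V) :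
    ∃ H : Subgroup G, H.FiniteIndex ∧ ∃ v : V, v ≠ 0 ∧ ∀ h ∈ H, ∃ c : ℂ, ρ h v = c • v := by
  induction hn : finrank ℂ V using Nat.strong_induction_on generalizing G V with
  | _ n ih =>
    rcases Nat.lt_or_ge 1 n with h1 | h1
    · obtain ⟨H, hH, W, hbot, htop, hW⟩ := exists_invariant_submodule hd ρ (hn ▸ h1)
      have : Nontrivial W := Submodule.nontrivial_iff_ne_bot.2 hbot
      obtain ⟨K, hK, v, hv, hKv⟩ := ih _ (hn ▸ Submodule.finrank_lt htop) (hd.subgroup H)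
        (Representation.subrepresentation (ρ.comp H.subtype) W fun h v hv => hW h h.2 v hv) rfl
      refine ⟨K.map H.subtype, ⟨?_⟩, v, by simpa using hv, ?_⟩
      · rw [Subgroup.index_map_subtype]
        exact mul_ne_zero hK.index_ne_zero hH.index_ne_zero
      · rintro _ ⟨k, hk, rfl⟩
        obtain ⟨c, hc⟩ := hKv k hk
        exact ⟨c, congrArg Subtype.val hc⟩
    · obtain ⟨v, hv⟩ := exists_ne (0 : V)
      have hpos : 0 < finrank ℂ V := finrank_pos
      have hone : finrank ℂ V = 1 := by omega
      refine ⟨⊤, inferInstance, v, hv, fun h _ => ?_⟩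
      obtain ⟨c, hc⟩ := (finrank_eq_one_iff_of_nonzero' v hv).1 hone (ρ h v)
      exact ⟨c, hc.symm⟩

theorem exists_isWeightFlag {G V : Type*} [Group G] [Group.FG G] {d : ℕ}
    (hd : HasGrowthDegree G d) [AddCommGroup V] [Module ℂ V] [FiniteDimensional ℂ V]
    (ρ : Representation ℂ G V) :
    ∃ H : Subgroup G, H.FiniteIndex ∧ ∃ (N : ℕ) (F : ℕ → Submodule ℂ V) (χ : ℕ → H →* ℂˣ),
      IsWeightFlag (ρ.comp H.subtype) N F χ := by
  induction hn : finrank ℂ V using Nat.strong_induction_on generalizing G V with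
  | _ n ih =>
    rcases subsingleton_or_nontrivial V with hV | hV
    · refine ⟨⊤, inferInstance, 0, fun _ => ⊥, fun _ => 1, ⟨fun _ _ _ => le_rfl, rfl,
        Subsingleton.elim _ _, fun i g v _ => ?_, fun _ _ => rfl⟩⟩
      rw [Submodule.mem_bot]
      exact Subsingleton.elim _ _
    obtain ⟨H, hH, v, hv, hHv⟩ := exists_common_eigenvector hd ρ
    choose c hc using fun h : H => hHv h h.2
    let θ : H →* ℂ :=
      { toFun := c
        map_one' := smul_left_injective ℂ hv <| by
          change c 1 • v = (1 : ℂ) • v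
          rw [← hc]; simp
        map_mul' := fun a b => smul_left_injective ℂ hv <| by
          change c (a * b) • v = (c a * c b) • v
          rw [← hc]
          simp [hc, smul_smul, mul_comm] }
    set L : Submodule ℂ V := Submodule.span ℂ {v} with hL
    have hLρ : ∀ h : H, L ≤ L.comap ((ρ.comp H.subtype) h) := by
      intro h
      rw [hL, Submodule.span_le, Set.singleton_subset_iff]
      exact Submodule.mem_span_singleton.2 ⟨c h, (hc h).symm⟩
    have hlt : finrank ℂ (V ⧸ L) < n := by
      have h1 := L.finrank_quotient_add_finrank
      have h2 : finrank ℂ L = 1 := finrank_span_singleton hv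
      omega
    obtain ⟨K, hK, N, F, χ, hF⟩ := ih _ hlt (hd.subgroup H)
      (Representation.quotient (ρ.comp H.subtype) L hLρ) rfl
    let F' : ℕ → Submodule ℂ V := fun i => Nat.casesOn i ⊥ fun i => (F i).comap L.mkQ
    let χ' : ℕ → K →* ℂˣ := fun i => Nat.casesOn i (θ.toHomUnits.comp K.subtype) fun i => χ i
    have hF' : IsWeightFlag ((ρ.comp H.subtype).comp K.subtype) (N + 1) F' χ' := by
      refine ⟨monotone_nat_of_le_succ ?_, rfl, ?_, ?_, ?_⟩
      · rintro (_ | i)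
        · exact bot_le
        · exact Submodule.comap_mono (hF.mono i.le_succ)
      · change (F N).comap L.mkQ = ⊤
        rw [hF.top, Submodule.comap_top]
      · rintro (_ | i) k w hw
        · change w ∈ (F 0).comap L.mkQ at hw
          rw [hF.bot, ← LinearMap.ker, Submodule.ker_mkQ, hL, Submodule.mem_span_singleton] at hw
          obtain ⟨a, rfl⟩ := hw
          change _ ∈ (⊥ : Submodule ℂ V)
          have h2 : ρ ((k : H) : G) v = θ k • v := hc k
          have h1 : ((χ' 0 k : ℂˣ) : ℂ) = θ k := rfl
          rw [Submodule.mem_bot, h1]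
          simp [h2, smul_comm a]
        · exact hF.sub_smul_mem i k _ hw
      · rintro (_ | i) hi
        · omega
        · exact hF.eq_one i (by omega)
    let e := K.equivMapOfInjective H.subtype H.subtype_injective
    refine ⟨K.map H.subtype, ⟨?_⟩, N + 1, F', fun i => (χ' i).comp e.symm.toMonoidHom, ?_⟩
    · rw [Subgroup.index_map_subtype]
      exact mul_ne_zero hK.index_ne_zero hH.index_ne_zero
    · convert hF'.comp e.symm.toMonoidHom using 1
      ext g : 1
      obtain ⟨k, rfl⟩ := e.surjective g
      simp [e]

end Triangularization

/-- (Tits) A finitely generated subgroup of `GL_n(ℂ)` of polynomial growth contains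
a nilpotent subgroup of finite index. -/
theorem stmt12 {n : ℕ} (G : Subgroup (Matrix.GeneralLinearGroup (Fin n) ℂ))
    (hfg : Group.FG G) (hpg : HasPolyGrowth G) :
    ∃ H : Subgroup G, Group.IsNilpotent H ∧ H.FiniteIndex := by
  obtain ⟨d, hd⟩ := hpg.exists_hasGrowthDegree
  let ρ : Representation ℂ G (Fin n → ℂ) :=
    (Matrix.toLinAlgEquiv' : Matrix (Fin n) (Fin n) ℂ ≃ₐ[ℂ] _).toAlgHom.toMonoidHom.comp
      ((Units.coeHom _).comp G.subtype)
  have hρ : Function.Injective ρ := fun a b hab =>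
    Subtype.ext (Units.ext (Matrix.toLinAlgEquiv'.injective hab))
  obtain ⟨H, hH, N, F, χ, hF⟩ := exists_isWeightFlag hd ρ
  obtain ⟨K, hK, hKi⟩ := hF.exists_isNilpotent (hd.subgroup H)
    (hρ.comp H.subtype_injective)
  refine ⟨K.map H.subtype, ?_, ⟨?_⟩⟩
  · exact Group.isNilpotent_congr (K.equivMapOfInjective H.subtype H.subtype_injective) |>.1 hK
  · rw [Subgroup.index_map_subtype]
    exact mul_ne_zero hKi.index_ne_zero hH.index_ne_zero
end
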